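/- arXiv:0812.3181 — 3 statements merged into one kernel-verified Lean document; each statement's English description precedes it below -/
import Mathlib

section
/- Let n ≥ 4. There is a constant C (depending only on n) such that for every ψ₀ ∈ 𝒮(ℝⁿ), every T > 0, and ψ the solution of the free Schrödinger equation with initial data ψ₀, the angular Morawetz estimate ∫_0^T ∫_{ℝⁿ} ( |∇_x ψ(t,x)|² − |(∂_r ψ)(t,x)|² ) / |x| dx dt ≤ C ‖ψ₀‖²_{H^{1/2}} holds (with C independent of T). Here |∇_x ψ|² − |∂_r ψ|² = | r^{-1/2} ∇̸ ψ |² · |x| is the squared norm of the angular part of the gradient, and is nonnegative. -/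
open MeasureTheory
open scoped RealInnerProductSpace

/-- The Fourier transform `û(ξ) = (2π)^{-n/2} ∫ u(x) e^{-i x·ξ} dx`. -/
noncomputable def fourierT {n : ℕ} (u : EuclideanSpace ℝ (Fin n) → ℂ)
    (ξ : EuclideanSpace ℝ (Fin n)) : ℂ :=
  ((2 * Real.pi) ^ (-(n : ℝ) / 2) : ℝ) *
    ∫ x, Complex.exp (-Complex.I * (⟪x, ξ⟫ : ℝ)) * u x

/-- The squared Sobolev norm `‖u‖²_{H^s} = ∫ (1+|ξ|²)^s |û(ξ)|² dξ`. -/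
noncomputable def sobolevNormSq {n : ℕ} (s : ℝ) (u : EuclideanSpace ℝ (Fin n) → ℂ) : ℝ :=
  ∫ ξ, (1 + ‖ξ‖ ^ 2) ^ s * ‖fourierT u ξ‖ ^ 2

/-- The solution of the free Schrödinger equation with initial data `ψ₀`:
`ψ(t,x) = (2π)^{-n/2} ∫ e^{i x·ξ} e^{-i t |ξ|²} ψ̂₀(ξ) dξ`. -/
noncomputable def schrodSol {n : ℕ} (ψ₀ : SchwartzMap (EuclideanSpace ℝ (Fin n)) ℂ)
    (t : ℝ) (x : EuclideanSpace ℝ (Fin n)) : ℂ :=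
  ((2 * Real.pi) ^ (-(n : ℝ) / 2) : ℝ) *
    ∫ ξ, Complex.exp (Complex.I * (⟪x, ξ⟫ : ℝ)) *
      Complex.exp (-Complex.I * (t : ℂ) * ((‖ξ‖ ^ 2 : ℝ) : ℂ)) * fourierT (⇑ψ₀) ξ

/-- Squared Euclidean norm of the full (spatial) gradient. -/
noncomputable def gradNormSq {n : ℕ} (u : EuclideanSpace ℝ (Fin n) → ℂ)
    (x : EuclideanSpace ℝ (Fin n)) : ℝ :=
  ∑ j : Fin n, ‖fderiv ℝ u x (EuclideanSpace.single j (1 : ℝ))‖ ^ 2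

/-- The radial derivative `(∂_r f)(x) = ⟨x/|x|, ∇f(x)⟩`. -/
noncomputable def radialDeriv {n : ℕ} (f : EuclideanSpace ℝ (Fin n) → ℂ)
    (x : EuclideanSpace ℝ (Fin n)) : ℂ :=
  fderiv ℝ f x (‖x‖⁻¹ • x)

namespace Morawetz

open scoped SchwartzMap FourierTransform LineDeriv Laplacian ComplexConjugate
open Filter Topology

/-- Embedding of the Schwartz space in `L²`, viewed as a real Hilbert space. -/
noncomputable def toL2 (n : ℕ) : 𝓢(EuclideanSpace ℝ (Fin n), ℂ) →L[ℝ]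
    Lp ℂ 2 (volume : Measure (EuclideanSpace ℝ (Fin n))) :=
  SchwartzMap.toLpCLM ℝ ℂ 2 volume

section Heinz

variable {V H : Type*} [AddCommGroup V] [Module ℝ V] [NormedAddCommGroup H]
  [InnerProductSpace ℝ H] {J : V →ₗ[ℝ] H}

/-- A symmetric operator satisfies `‖Kg‖^N ‖g‖ ≤ ‖g‖^N ‖K^N g‖` for `N = 2 ^ m`. -/
lemma norm_pow_mul_le_of_symm {K : V →ₗ[ℝ] V}
    (hK : ∀ f g, ⟪J (K f), J g⟫ = ⟪J f, J (K g)⟫) (g : V) (m : ℕ) :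
    ‖J (K g)‖ ^ 2 ^ m * ‖J g‖ ≤ ‖J g‖ ^ 2 ^ m * ‖J ((K ^ 2 ^ m) g)‖ := by
  have hpow : ∀ (k : ℕ) (f g : V), ⟪J ((K ^ k) f), J g⟫ = ⟪J f, J ((K ^ k) g)⟫ := by
    intro k
    induction k with
    | zero => simp
    | succ k ih =>
      intro f g
      rw [pow_succ, Module.End.mul_apply, ih, hK, ← Module.End.mul_apply, ← pow_succ']
      rfl
  have hsq : ∀ k : ℕ, ‖J ((K ^ k) g)‖ ^ 2 ≤ ‖J g‖ * ‖J ((K ^ (2 * k)) g)‖ := by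
    intro k
    rw [← real_inner_self_eq_norm_sq, hpow, ← Module.End.mul_apply, ← pow_add, ← two_mul]
    exact real_inner_le_norm _ _
  rcases (norm_nonneg (J g)).eq_or_lt with h0 | h0
  · have h := hsq 1
    rw [← h0, zero_mul, pow_one] at h
    have h1 : ‖J (K g)‖ = 0 := by nlinarith [norm_nonneg (J (K g))]
    simp [h1, ← h0]
  induction m with
  | zero => simp [mul_comm]
  | succ m ih =>
    have h := hsq (2 ^ m)
    rw [← pow_succ'] at h
    have h2 := pow_le_pow_left₀ (by positivity) ih 2
    refine le_of_mul_le_mul_right ?_ h0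
    calc ‖J (K g)‖ ^ 2 ^ (m + 1) * ‖J g‖ * ‖J g‖
        = (‖J (K g)‖ ^ 2 ^ m * ‖J g‖) ^ 2 := by ring
      _ ≤ (‖J g‖ ^ 2 ^ m * ‖J ((K ^ 2 ^ m) g)‖) ^ 2 := h2
      _ = (‖J g‖ ^ 2 ^ m) ^ 2 * ‖J ((K ^ 2 ^ m) g)‖ ^ 2 := by ring
      _ ≤ (‖J g‖ ^ 2 ^ m) ^ 2 * (‖J g‖ * ‖J ((K ^ 2 ^ (m + 1)) g)‖) := by gcongr
      _ = ‖J g‖ ^ 2 ^ (m + 1) * ‖J ((K ^ 2 ^ (m + 1)) g)‖ * ‖J g‖ := by ring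

/-- A symmetric operator whose powers grow at most like `C ^ N` is bounded by `C`. -/
lemma norm_le_of_symm_of_pow_le {K : V →ₗ[ℝ] V} {C : ℝ} (hC : 0 < C)
    (hK : ∀ f g, ⟪J (K f), J g⟫ = ⟪J f, J (K g)⟫) (g : V) {D : ℝ}
    (hD : ∀ N : ℕ, ‖J ((K ^ N) g)‖ ≤ C ^ N * D) : ‖J (K g)‖ ≤ C * ‖J g‖ := by
  rcases (norm_nonneg (J g)).eq_or_lt with h0 | h0
  · have h : ‖J (K g)‖ ^ 2 ≤ 0 := by
      rw [← real_inner_self_eq_norm_sq, hK, norm_eq_zero.1 h0.symm, inner_zero_left]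
    rw [← h0, mul_zero]
    nlinarith [norm_nonneg (J (K g))]
  by_contra! hlt
  have hq : 1 < ‖J (K g)‖ / (C * ‖J g‖) := (one_lt_div (by positivity)).2 hlt
  obtain ⟨m, hm⟩ := ((tendsto_pow_atTop_atTop_of_one_lt hq).comp
    (tendsto_pow_atTop_atTop_of_one_lt one_lt_two)).eventually_gt_atTop (D / ‖J g‖) |>.exists
  have h1 := norm_pow_mul_le_of_symm hK g m
  have h2 : ‖J (K g)‖ ^ 2 ^ m * ‖J g‖ ≤ ‖J g‖ ^ 2 ^ m * (C ^ 2 ^ m * D) :=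
    h1.trans (by gcongr; exact hD _)
  simp only [Function.comp_apply, div_pow, mul_pow] at hm
  rw [div_lt_div_iff₀ h0 (by positivity)] at hm
  linarith

/-- Heinz inequality: if `A` is symmetric and `‖A f‖ ≤ C ‖L² f‖`, then `⟪f, A f⟫ ≤ C ‖L f‖²`. -/
lemma abs_inner_le_of_norm_le {A L L' : V →ₗ[ℝ] V} {C : ℝ} (hC : 0 < C)
    (hA : ∀ f g, ⟪J (A f), J g⟫ = ⟪J f, J (A g)⟫)
    (hL' : ∀ f g, ⟪J (L' f), J g⟫ = ⟪J f, J (L' g)⟫)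
    (hLL' : ∀ f, L (L' f) = f) (hL'L : ∀ f, L' (L f) = f) (hle : ∀ f, ‖J (L' f)‖ ≤ ‖J f‖)
    (hAL : ∀ f, ‖J (A f)‖ ≤ C * ‖J (L (L f))‖) (f : V) :
    |⟪J f, J (A f)⟫| ≤ C * ‖J (L f)‖ ^ 2 := by
  set K : V →ₗ[ℝ] V := L' ∘ₗ A ∘ₗ L' with hKdef
  have hK : ∀ f g, ⟪J (K f), J g⟫ = ⟪J f, J (K g)⟫ := fun f g => by
    simp only [hKdef, LinearMap.comp_apply, hL', hA]
  have hbd : ∀ f, ‖J (L' (A (L' f)))‖ ≤ ‖J (A (L' f))‖ := fun f => hle _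
  have hpow : ∀ (N : ℕ) (g : V), ‖J ((K ^ N) g)‖ ≤ C ^ N * ‖J (L g)‖ := by
    have aux : ∀ (N : ℕ) (g : V), ‖J (L ((K ^ N) g))‖ ≤ C ^ N * ‖J (L g)‖ := by
      intro N
      induction N with
      | zero => simp
      | succ N ih =>
        intro g
        rw [pow_succ', Module.End.mul_apply, hKdef, LinearMap.comp_apply, LinearMap.comp_apply,
          hLL', ← hKdef, pow_succ', mul_assoc]
        refine (hAL _).trans ?_
        rw [hLL']
        exact mul_le_mul_of_nonneg_left (ih g) hC.le
    intro N g
    refine le_trans ?_ (aux N g)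
    conv_lhs => rw [← hL'L ((K ^ N) g)]
    exact hle _
  have h := norm_le_of_symm_of_pow_le hC hK (L f) (fun N => hpow N (L f))
  have hKL : J (K (L f)) = J (L' (A f)) := by simp [hKdef, hL'L]
  calc |⟪J f, J (A f)⟫| = |⟪J (L f), J (K (L f))⟫| := by
        rw [hKL, ← hL', hL'L]
    _ ≤ ‖J (L f)‖ * ‖J (K (L f))‖ := abs_real_inner_le_norm _ _
    _ ≤ ‖J (L f)‖ * (C * ‖J (L f)‖) := by gcongr
    _ = C * ‖J (L f)‖ ^ 2 := by ring

end Heinz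

variable {n : ℕ}

lemma inner_toL2 (f g : 𝓢(EuclideanSpace ℝ (Fin n), ℂ)) :
    ⟪toL2 n f, toL2 n g⟫ = ∫ x, ⟪f x, g x⟫ := by
  rw [L2.inner_def]
  apply integral_congr_ae
  filter_upwards [f.coeFn_toLp 2 volume, g.coeFn_toLp 2 volume] with x hf hg
  simp only [toL2, SchwartzMap.toLpCLM_apply, hf, hg]

lemma norm_toL2_le_mul {f g : 𝓢(EuclideanSpace ℝ (Fin n), ℂ)} {c : ℝ}
    (h : ∀ x, ‖f x‖ ≤ c * ‖g x‖) : ‖toL2 n f‖ ≤ c * ‖toL2 n g‖ := by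
  apply Lp.norm_le_mul_norm_of_ae_le_mul
  filter_upwards [f.coeFn_toLp 2 volume, g.coeFn_toLp 2 volume] with x hf hg
  simpa only [toL2, SchwartzMap.toLpCLM_apply, hf, hg] using h x

lemma inner_toL2_fourier (f g : 𝓢(EuclideanSpace ℝ (Fin n), ℂ)) :
    ⟪toL2 n (𝓕 f), toL2 n (𝓕 g)⟫ = ⟪toL2 n f, toL2 n g⟫ := by
  have h := congrArg Complex.re (SchwartzMap.inner_fourier_toL2_eq f g)
  rw [SchwartzMap.inner_toL2_toL2_eq _ _ volume, SchwartzMap.inner_toL2_toL2_eq _ _ volume] at h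
  have key : ∀ u v : 𝓢(EuclideanSpace ℝ (Fin n), ℂ),
      ⟪toL2 n u, toL2 n v⟫ = (∫ x, inner ℂ (u x) (v x)).re := by
    intro u v
    rw [inner_toL2]
    have hi : Integrable (fun x => inner ℂ (u x) (v x)) := by
      have := L2.integrable_inner (𝕜 := ℂ) (u.toLp 2 volume) (v.toLp 2 volume)
      refine this.congr ?_
      filter_upwards [u.coeFn_toLp 2 volume, v.coeFn_toLp 2 volume] with x hf hg
      rw [hf, hg]
    rw [← Complex.reCLM_apply, ← ContinuousLinearMap.integral_comp_comm _ hi]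
    simp [Complex.inner]
  rw [key, key, h]

lemma norm_toL2_fourier (f : 𝓢(EuclideanSpace ℝ (Fin n), ℂ)) :
    ‖toL2 n (𝓕 f)‖ = ‖toL2 n f‖ := by
  rw [← sq_eq_sq₀ (norm_nonneg _) (norm_nonneg _), ← real_inner_self_eq_norm_sq,
    ← real_inner_self_eq_norm_sq, inner_toL2_fourier]

lemma norm_toL2_le_of_fourier {f g : 𝓢(EuclideanSpace ℝ (Fin n), ℂ)} {c : ℝ}
    (h : ∀ x, ‖𝓕 f x‖ ≤ c * ‖𝓕 g x‖) : ‖toL2 n f‖ ≤ c * ‖toL2 n g‖ := by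
  rw [← norm_toL2_fourier f, ← norm_toL2_fourier g]
  exact norm_toL2_le_mul h

lemma norm_sq_toL2 (f : 𝓢(EuclideanSpace ℝ (Fin n), ℂ)) :
    ‖toL2 n f‖ ^ 2 = ∫ x, ‖f x‖ ^ 2 := by
  rw [← real_inner_self_eq_norm_sq, inner_toL2]
  simp only [real_inner_self_eq_norm_sq]

lemma inner_toL2_I_smul (f g : 𝓢(EuclideanSpace ℝ (Fin n), ℂ)) :
    ⟪toL2 n (Complex.I • f), toL2 n g⟫ = -⟪toL2 n f, toL2 n (Complex.I • g)⟫ := by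
  rw [inner_toL2, inner_toL2, ← integral_neg]
  congr with x
  simp [Complex.inner]
  ring

lemma inner_toL2_lineDeriv (f g : 𝓢(EuclideanSpace ℝ (Fin n), ℂ))
    (v : EuclideanSpace ℝ (Fin n)) :
    ⟪toL2 n (∂_{v} f), toL2 n g⟫ = -⟪toL2 n f, toL2 n (∂_{v} g)⟫ := by
  rw [inner_toL2, inner_toL2]
  have : ∫ x, ⟪f x, ∂_{v} g x⟫ = -∫ x, ⟪∂_{v} f x, g x⟫ :=
    SchwartzMap.integral_bilinear_lineDerivOp_right_eq_neg_left f g (innerSL ℝ (E := ℂ)) v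
  rw [this, neg_neg]

lemma inner_toL2_smulLeft {φ : EuclideanSpace ℝ (Fin n) → ℝ} (hφ : φ.HasTemperateGrowth)
    (f g : 𝓢(EuclideanSpace ℝ (Fin n), ℂ)) :
    ⟪toL2 n (SchwartzMap.smulLeftCLM ℂ φ f), toL2 n g⟫ =
      ⟪toL2 n f, toL2 n (SchwartzMap.smulLeftCLM ℂ φ g)⟫ := by
  rw [inner_toL2, inner_toL2]
  congr with x
  rw [SchwartzMap.smulLeftCLM_apply_apply hφ, SchwartzMap.smulLeftCLM_apply_apply hφ,
    real_inner_smul_left, real_inner_smul_right]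

lemma lineDeriv_smulLeft {φ φ' : EuclideanSpace ℝ (Fin n) → ℝ} (hφ : φ.HasTemperateGrowth)
    (hφ' : φ'.HasTemperateGrowth) {v : EuclideanSpace ℝ (Fin n)}
    (h : ∀ x, fderiv ℝ φ x v = φ' x) (f : 𝓢(EuclideanSpace ℝ (Fin n), ℂ)) :
    ∂_{v} (SchwartzMap.smulLeftCLM ℂ φ f) =
      SchwartzMap.smulLeftCLM ℂ φ (∂_{v} f) + SchwartzMap.smulLeftCLM ℂ φ' f := by
  ext x
  have hd : DifferentiableAt ℝ φ x := (hφ.1.differentiable (by simp)).differentiableAt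
  rw [add_apply, SchwartzMap.smulLeftCLM_apply_apply hφ,
    SchwartzMap.smulLeftCLM_apply_apply hφ', SchwartzMap.lineDerivOp_apply_eq_fderiv,
    SchwartzMap.smulLeftCLM_apply hφ, SchwartzMap.lineDerivOp_apply_eq_fderiv,
    fderiv_fun_smul hd f.differentiableAt]
  simp [h]

/-- `2 Re ∫ φ f̄ ∂f = -∫ φ' |f|²`. -/
lemma two_mul_inner_smulLeft_lineDeriv {φ φ' : EuclideanSpace ℝ (Fin n) → ℝ}
    (hφ : φ.HasTemperateGrowth)
    (hφ' : φ'.HasTemperateGrowth) {v : EuclideanSpace ℝ (Fin n)}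
    (h : ∀ x, fderiv ℝ φ x v = φ' x) (f : 𝓢(EuclideanSpace ℝ (Fin n), ℂ)) :
    2 * ⟪toL2 n (SchwartzMap.smulLeftCLM ℂ φ f), toL2 n (∂_{v} f)⟫ =
      -⟪toL2 n (SchwartzMap.smulLeftCLM ℂ φ' f), toL2 n f⟫ := by
  have h1 := inner_toL2_lineDeriv (SchwartzMap.smulLeftCLM ℂ φ f) f v
  rw [lineDeriv_smulLeft hφ hφ' h, map_add, inner_add_left,
    inner_toL2_smulLeft hφ, real_inner_comm] at h1
  linarith

/-- The weight `(δ + |x|²)^p`. -/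
noncomputable def wt {n : ℕ} (δ p : ℝ) (x : EuclideanSpace ℝ (Fin n)) : ℝ := (δ + ‖x‖ ^ 2) ^ p

lemma wt_pos {δ : ℝ} (hδ : 0 < δ) (p : ℝ) (x : EuclideanSpace ℝ (Fin n)) : 0 < wt δ p x := by
  unfold wt
  positivity

lemma mul_wt_sub_one {δ : ℝ} (hδ : 0 < δ) (p : ℝ) (x : EuclideanSpace ℝ (Fin n)) :
    (δ + ‖x‖ ^ 2) * wt δ (p - 1) x = wt δ p x := by
  unfold wt
  rw [Real.rpow_sub_one (by positivity)]
  field_simp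

lemma wt_mul_wt {δ : ℝ} (hδ : 0 < δ) (p q : ℝ) (x : EuclideanSpace ℝ (Fin n)) :
    wt δ p x * wt δ q x = wt δ (p + q) x :=
  (Real.rpow_add (by positivity) p q).symm

@[fun_prop]
lemma hasTemperateGrowth_wt {δ : ℝ} (hδ : 0 < δ) (p : ℝ) :
    (wt δ p : EuclideanSpace ℝ (Fin n) → ℝ).HasTemperateGrowth := by
  have h1 := (Function.hasTemperateGrowth_one_add_norm_sq_rpow (EuclideanSpace ℝ (Fin n)) p).comp
    ((√δ)⁻¹ • ContinuousLinearMap.id ℝ (EuclideanSpace ℝ (Fin n))).hasTemperateGrowth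
  have h2 := (Function.HasTemperateGrowth.const (E := EuclideanSpace ℝ (Fin n)) (δ ^ p)).mul h1
  convert! h2 using 1
  ext x
  simp only [wt, Pi.mul_apply, Function.comp_apply, smul_apply,
    ContinuousLinearMap.id_apply, norm_smul, norm_inv, Real.norm_eq_abs, mul_pow, inv_pow, sq_abs,
    Real.sq_sqrt hδ.le]
  rw [← Real.mul_rpow hδ.le (by positivity)]
  congr 1
  field_simp

lemma hasFDerivAt_wt {δ : ℝ} (hδ : 0 < δ) (p : ℝ) (x : EuclideanSpace ℝ (Fin n)) :
    HasFDerivAt (wt δ p) ((2 * p * wt δ (p - 1) x) • innerSL ℝ x) x := by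
  have h := ((hasFDerivAt_id x).norm_sq.const_add δ).rpow_const (p := p)
    (Or.inl (by simp only [id]; positivity))
  convert! h using 1
  ext v
  simp [wt]
  ring

@[fun_prop]
lemma hasTemperateGrowth_coord (j : Fin n) :
    (fun x : EuclideanSpace ℝ (Fin n) => x j).HasTemperateGrowth :=
  (EuclideanSpace.proj j : EuclideanSpace ℝ (Fin n) →L[ℝ] ℝ).hasTemperateGrowth

/-- The standard basis vector `e_j`. -/
noncomputable abbrev e (j : Fin n) : EuclideanSpace ℝ (Fin n) := EuclideanSpace.single j (1 : ℝ)

lemma fderiv_wt {δ : ℝ} (hδ : 0 < δ) (p : ℝ) (x : EuclideanSpace ℝ (Fin n)) (j : Fin n) :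
    fderiv ℝ (wt δ p) x (e j) = 2 * p * x j * wt δ (p - 1) x := by
  rw [(hasFDerivAt_wt hδ p x).fderiv]
  simp [e, EuclideanSpace.inner_single_right]
  ring

lemma fderiv_coord_mul {φ : EuclideanSpace ℝ (Fin n) → ℝ} {x : EuclideanSpace ℝ (Fin n)}
    (hφ : DifferentiableAt ℝ φ x) (j k : Fin n) :
    fderiv ℝ (fun y : EuclideanSpace ℝ (Fin n) => y k * φ y) x (e j) =
      (if j = k then φ x else 0) + x k * fderiv ℝ φ x (e j) := by
  have h : HasFDerivAt (fun y : EuclideanSpace ℝ (Fin n) => y k)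
    (EuclideanSpace.proj k : EuclideanSpace ℝ (Fin n) →L[ℝ] ℝ) x :=
    (EuclideanSpace.proj k : EuclideanSpace ℝ (Fin n) →L[ℝ] ℝ).hasFDerivAt
  have hm : HasFDerivAt (fun y : EuclideanSpace ℝ (Fin n) => y k * φ y) _ x :=
    h.mul hφ.hasFDerivAt
  rw [hm.fderiv]
  by_cases hjk : j = k
  · subst hjk; simp [e]; ring
  · simp [e, hjk, Ne.symm hjk]

lemma sum_coord_sq (x : EuclideanSpace ℝ (Fin n)) : ∑ j, x j ^ 2 = ‖x‖ ^ 2 := by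
  rw [EuclideanSpace.norm_sq_eq]
  simp

/-- The regularised Morawetz vector field `x_k (δ + |x|²)^{-1/2}`. -/
noncomputable def field (δ : ℝ) (k : Fin n) (x : EuclideanSpace ℝ (Fin n)) : ℝ :=
  x k * wt δ (-1 / 2) x

/-- The derivative `∂_j` of the `k`-th component of the Morawetz field. -/
noncomputable def fieldDeriv (δ : ℝ) (j k : Fin n) (x : EuclideanSpace ℝ (Fin n)) : ℝ :=
  (if j = k then wt δ (-1 / 2) x else 0) - x k * (x j * wt δ (-3 / 2) x)

/-- Half of the divergence of the Morawetz field. -/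
noncomputable def halfDiv (δ : ℝ) (x : EuclideanSpace ℝ (Fin n)) : ℝ :=
  ((n : ℝ) - 1) / 2 * wt δ (-1 / 2) x + δ / 2 * wt δ (-3 / 2) x

/-- The partial derivatives of `halfDiv` are `x_j` times this radial function. -/
noncomputable def halfDivRad (δ : ℝ) (x : EuclideanSpace ℝ (Fin n)) : ℝ :=
  -((n : ℝ) - 1) / 2 * wt δ (-3 / 2) x - 3 * δ / 2 * wt δ (-5 / 2) x

/-- The second derivative `∂_j² halfDiv`. -/
noncomputable def halfDivSnd (δ : ℝ) (j : Fin n) (x : EuclideanSpace ℝ (Fin n)) : ℝ :=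
  halfDivRad δ x + x j * (x j * (3 * ((n : ℝ) - 1) / 2 * wt δ (-5 / 2) x
    + 15 * δ / 2 * wt δ (-7 / 2) x))

section Weights

variable {δ : ℝ}

@[fun_prop]
lemma hasTemperateGrowth_field (hδ : 0 < δ) (k : Fin n) : (field δ k).HasTemperateGrowth :=
  (hasTemperateGrowth_coord k).mul (hasTemperateGrowth_wt hδ _)

@[fun_prop]
lemma hasTemperateGrowth_fieldDeriv (hδ : 0 < δ) (j k : Fin n) :
    (fieldDeriv δ j k).HasTemperateGrowth := by
  have h := (hasTemperateGrowth_coord k).mul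
    ((hasTemperateGrowth_coord j).mul (hasTemperateGrowth_wt hδ (-3 / 2)))
  by_cases hjk : j = k
  · convert! (hasTemperateGrowth_wt hδ (-1 / 2)).sub h using 1
    ext x
    simp [fieldDeriv, hjk]
  · convert! (Function.HasTemperateGrowth.const (0 : ℝ)).sub h using 1
    ext x
    simp [fieldDeriv, hjk]

@[fun_prop]
lemma hasTemperateGrowth_halfDiv (hδ : 0 < δ) : (halfDiv (n := n) δ).HasTemperateGrowth :=
  ((Function.HasTemperateGrowth.const _).mul (hasTemperateGrowth_wt hδ _)).add
    ((Function.HasTemperateGrowth.const _).mul (hasTemperateGrowth_wt hδ _))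

@[fun_prop]
lemma hasTemperateGrowth_halfDivRad (hδ : 0 < δ) : (halfDivRad (n := n) δ).HasTemperateGrowth :=
  ((Function.HasTemperateGrowth.const _).mul (hasTemperateGrowth_wt hδ _)).sub
    ((Function.HasTemperateGrowth.const _).mul (hasTemperateGrowth_wt hδ _))

@[fun_prop]
lemma hasTemperateGrowth_halfDivSnd (hδ : 0 < δ) (j : Fin n) :
    (halfDivSnd δ j).HasTemperateGrowth :=
  (hasTemperateGrowth_halfDivRad hδ).add ((hasTemperateGrowth_coord j).mul
    ((hasTemperateGrowth_coord j).mul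
      (((Function.HasTemperateGrowth.const _).mul (hasTemperateGrowth_wt hδ _)).add
        ((Function.HasTemperateGrowth.const _).mul (hasTemperateGrowth_wt hδ _)))))

lemma fderiv_field (hδ : 0 < δ) (j k : Fin n) (x : EuclideanSpace ℝ (Fin n)) :
    fderiv ℝ (field δ k) x (e j) = fieldDeriv δ j k x := by
  have h := fderiv_coord_mul (hasFDerivAt_wt hδ (-1 / 2) x).differentiableAt j k
  rw [fderiv_wt hδ] at h
  refine h.trans ?_
  norm_num [fieldDeriv]
  ring

lemma fderiv_comb_wt (hδ : 0 < δ) (a b p q : ℝ) (j : Fin n) (x : EuclideanSpace ℝ (Fin n)) :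
    fderiv ℝ (fun y => a * wt δ p y + b * wt δ q y) x (e j) =
      x j * (2 * p * a * wt δ (p - 1) x + 2 * q * b * wt δ (q - 1) x) := by
  have hp := (hasFDerivAt_wt hδ p x).differentiableAt
  have hq := (hasFDerivAt_wt hδ q x).differentiableAt
  rw [fderiv_fun_add (hp.const_mul a) (hq.const_mul b), fderiv_const_mul hp, fderiv_const_mul hq]
  simp only [add_apply, smul_apply, fderiv_wt hδ,
    smul_eq_mul]
  ring

lemma fderiv_halfDiv (hδ : 0 < δ) (j : Fin n) (x : EuclideanSpace ℝ (Fin n)) :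
    fderiv ℝ (halfDiv δ) x (e j) = x j * halfDivRad δ x := by
  refine (fderiv_comb_wt hδ _ _ _ _ j x).trans ?_
  norm_num [halfDivRad]
  ring_nf
  simp

lemma fderiv_coord_mul_halfDivRad (hδ : 0 < δ) (j : Fin n) (x : EuclideanSpace ℝ (Fin n)) :
    fderiv ℝ (fun y : EuclideanSpace ℝ (Fin n) => y j * halfDivRad δ y) x (e j) =
      halfDivSnd δ j x := by
  rw [fderiv_coord_mul
    ((hasTemperateGrowth_halfDivRad hδ).1.differentiable (by simp)).differentiableAt]
  have h := fderiv_comb_wt hδ (-((n : ℝ) - 1) / 2) (-(3 * δ / 2)) (-3 / 2) (-5 / 2) j x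
  have h' : (fun y : EuclideanSpace ℝ (Fin n) => -((n : ℝ) - 1) / 2 * wt δ (-3 / 2) y +
      -(3 * δ / 2) * wt δ (-5 / 2) y) = halfDivRad δ := by
    ext y
    simp only [halfDivRad]
    ring
  rw [h'] at h
  rw [h, halfDivSnd, if_pos rfl]
  norm_num
  ring_nf
  simp

lemma sum_fieldDeriv (hδ : 0 < δ) (x : EuclideanSpace ℝ (Fin n)) :
    ∑ k, fieldDeriv δ k k x = 2 * halfDiv δ x := by
  have h := mul_wt_sub_one hδ (-1 / 2) x
  norm_num at h
  have h2 : ∑ k, x k * (x k * wt δ (-3 / 2) x) = ‖x‖ ^ 2 * wt δ (-3 / 2) x := by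
    rw [← sum_coord_sq, Finset.sum_mul]
    exact Finset.sum_congr rfl fun k _ => by ring
  simp only [fieldDeriv, if_true, Finset.sum_sub_distrib, h2, halfDiv]
  norm_num
  linarith

lemma sum_halfDivSnd_nonpos (hδ : 0 < δ) (hn : 4 ≤ n) (x : EuclideanSpace ℝ (Fin n)) :
    ∑ j, halfDivSnd δ j x ≤ 0 := by
  have h5 := mul_wt_sub_one hδ (-3 / 2) x
  have h7 := mul_wt_sub_one hδ (-5 / 2) x
  norm_num at h5 h7
  have h2 : ∀ s : ℝ, ∑ k, x k * (x k * s) = ‖x‖ ^ 2 * s := by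
    intro s
    rw [← sum_coord_sq, Finset.sum_mul]
    exact Finset.sum_congr rfl fun k _ => by ring
  have hn' : (4 : ℝ) ≤ n := by exact_mod_cast hn
  have p3 := wt_pos hδ (-3 / 2) x
  have p5 := mul_pos hδ (wt_pos hδ (-5 / 2) x)
  have p7 := mul_pos (mul_pos hδ hδ) (wt_pos hδ (-7 / 2) x)
  simp only [halfDivSnd, Finset.sum_add_distrib, h2, halfDivRad, Finset.sum_const,
    Finset.card_univ, Fintype.card_fin, nsmul_eq_mul]
  norm_num at p3 p5 p7 ⊢
  set w3 := wt δ (-(3 / 2)) x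
  set w5 := wt δ (-(5 / 2)) x
  set w7 := wt δ (-(7 / 2)) x
  have e5 : ‖x‖ ^ 2 * w5 = w3 - δ * w5 := by linarith
  have e7 : ‖x‖ ^ 2 * w7 = w5 - δ * w7 := by linarith
  have hexp : ↑n * (-((n : ℝ) - 1) / 2 * w3 - 3 * δ / 2 * w5) +
      ‖x‖ ^ 2 * (3 * ((n : ℝ) - 1) / 2 * w5 + 15 * δ / 2 * w7) =
      -((n : ℝ) - 1) * (n - 3) / 2 * w3 - 3 * (n - 3) * (δ * w5) - 15 / 2 * (δ * δ * w7) := by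
    linear_combination (3 * ((n : ℝ) - 1) / 2) * e5 + (15 * δ / 2) * e7
  have a3 : 0 ≤ ((n : ℝ) - 1) * (n - 3) * w3 :=
    mul_nonneg (mul_nonneg (by linarith) (by linarith)) p3.le
  have a5 : 0 ≤ ((n : ℝ) - 3) * (δ * w5) := mul_nonneg (by linarith) p5.le
  ring_nf at hexp a3 a5 p7 ⊢
  linarith

end Weights

/-- The antisymmetric operator `P f = b · ∇f + (div b / 2) f`, with `b = x (δ + |x|²)^{-1/2}`. -/
noncomputable def morawetzOp (n : ℕ) (δ : ℝ) :
    𝓢(EuclideanSpace ℝ (Fin n), ℂ) →ₗ[ℝ] 𝓢(EuclideanSpace ℝ (Fin n), ℂ) :=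
  (∑ k, (SchwartzMap.smulLeftCLM ℂ (field δ k) ∘L
    LineDeriv.lineDerivOpCLM ℝ 𝓢(EuclideanSpace ℝ (Fin n), ℂ) (e k))
    + SchwartzMap.smulLeftCLM ℂ (halfDiv δ)).toLinearMap

lemma morawetzOp_apply (δ : ℝ) (f : 𝓢(EuclideanSpace ℝ (Fin n), ℂ)) :
    morawetzOp n δ f = ∑ k, SchwartzMap.smulLeftCLM ℂ (field δ k) (∂_{e k} f) +
      SchwartzMap.smulLeftCLM ℂ (halfDiv δ) f := by
  simp [morawetzOp]

lemma sum_smulLeft_fieldDeriv {δ : ℝ} (hδ : 0 < δ) (f : 𝓢(EuclideanSpace ℝ (Fin n), ℂ)) :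
    ∑ k, SchwartzMap.smulLeftCLM ℂ (fieldDeriv δ k k) f =
      (2 : ℝ) • SchwartzMap.smulLeftCLM ℂ (halfDiv δ) f := by
  ext x
  simp only [sum_apply, smul_apply,
    SchwartzMap.smulLeftCLM_apply_apply (hasTemperateGrowth_fieldDeriv hδ _ _),
    SchwartzMap.smulLeftCLM_apply_apply (hasTemperateGrowth_halfDiv hδ), ← Finset.sum_smul,
    sum_fieldDeriv hδ, smul_smul]

lemma lineDeriv_smulLeft_field {δ : ℝ} (hδ : 0 < δ) (j k : Fin n)
    (f : 𝓢(EuclideanSpace ℝ (Fin n), ℂ)) :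
    ∂_{e j} (SchwartzMap.smulLeftCLM ℂ (field δ k) f) =
      SchwartzMap.smulLeftCLM ℂ (field δ k) (∂_{e j} f) +
        SchwartzMap.smulLeftCLM ℂ (fieldDeriv δ j k) f :=
  lineDeriv_smulLeft (hasTemperateGrowth_field hδ k) (hasTemperateGrowth_fieldDeriv hδ j k)
    (fderiv_field hδ j k) f

lemma inner_morawetzOp {δ : ℝ} (hδ : 0 < δ) (f g : 𝓢(EuclideanSpace ℝ (Fin n), ℂ)) :
    ⟪toL2 n (morawetzOp n δ f), toL2 n g⟫ = -⟪toL2 n f, toL2 n (morawetzOp n δ g)⟫ := by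
  have h : ∀ k, ⟪toL2 n (SchwartzMap.smulLeftCLM ℂ (field δ k) (∂_{e k} f)), toL2 n g⟫ =
      -⟪toL2 n f, toL2 n (SchwartzMap.smulLeftCLM ℂ (field δ k) (∂_{e k} g))⟫
      - ⟪toL2 n f, toL2 n (SchwartzMap.smulLeftCLM ℂ (fieldDeriv δ k k) g)⟫ := by
    intro k
    rw [inner_toL2_smulLeft (hasTemperateGrowth_field hδ k), inner_toL2_lineDeriv,
      lineDeriv_smulLeft_field hδ, map_add, inner_add_right]
    ring
  have h2 := congrArg (fun u => ⟪toL2 n f, toL2 n u⟫) (sum_smulLeft_fieldDeriv hδ g)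
  simp only [map_sum, map_smul, inner_sum, inner_smul_right] at h2
  simp only [morawetzOp_apply, map_add, map_sum, inner_add_left, inner_add_right, sum_inner,
    inner_sum, h, Finset.sum_sub_distrib, Finset.sum_neg_distrib, h2,
    inner_toL2_smulLeft (hasTemperateGrowth_halfDiv hδ)]
  ring

lemma inner_morawetzOp_self {δ : ℝ} (hδ : 0 < δ) (f : 𝓢(EuclideanSpace ℝ (Fin n), ℂ)) :
    ⟪toL2 n (morawetzOp n δ f), toL2 n f⟫ = 0 := by
  have h := inner_morawetzOp hδ f f
  rw [real_inner_comm (toL2 n (morawetzOp n δ f))] at h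
  linarith

/-- The commutator of `∂_j` with the Morawetz operator. -/
lemma lineDeriv_morawetzOp {δ : ℝ} (hδ : 0 < δ) (j : Fin n)
    (f : 𝓢(EuclideanSpace ℝ (Fin n), ℂ)) :
    ∂_{e j} (morawetzOp n δ f) = morawetzOp n δ (∂_{e j} f) +
      (∑ k, SchwartzMap.smulLeftCLM ℂ (fieldDeriv δ j k) (∂_{e k} f) +
        SchwartzMap.smulLeftCLM ℂ (fun x => x j * halfDivRad δ x) f) := by
  have hr := lineDeriv_smulLeft (hasTemperateGrowth_halfDiv hδ)
    ((hasTemperateGrowth_coord j).mul (hasTemperateGrowth_halfDivRad hδ))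
    (fderiv_halfDiv hδ j) f
  have hs : ∂_{e j} (∑ k : Fin n, SchwartzMap.smulLeftCLM ℂ (field δ k) (∂_{e k} f)) =
      ∑ k : Fin n, ∂_{e j} (SchwartzMap.smulLeftCLM ℂ (field δ k) (∂_{e k} f)) := by
    rw [LineDeriv.lineDerivOp_sum]
  have hcomm : ∀ k : Fin n, ∂_{e j} (∂_{e k} f) = ∂_{e k} (∂_{e j} f) := by
    intro k
    ext x
    have h2 : IsSymmSndFDerivAt ℝ f x :=
      (f.smooth 2).contDiffAt.isSymmSndFDerivAt (by simp)
    have hd : ∀ (v w : EuclideanSpace ℝ (Fin n)), ∂_{v} (∂_{w} f) x =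
        fderiv ℝ (fderiv ℝ f) x v w := by
      intro v w
      have hf : DifferentiableAt ℝ (fderiv ℝ f) x :=
        ((f.smooth 2).fderiv_right (m := 1) (by norm_num)).differentiable (by simp) x
      rw [SchwartzMap.lineDerivOp_apply_eq_fderiv]
      have : ⇑(∂_{w} f : 𝓢(EuclideanSpace ℝ (Fin n), ℂ)) = fun y => fderiv ℝ f y w := rfl
      rw [this, fderiv_clm_apply hf (differentiableAt_const _)]
      simp
    rw [hd, hd]
    exact h2 _ _
  rw [morawetzOp_apply, LineDeriv.lineDerivOp_add, hr, hs, morawetzOp_apply]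
  simp only [lineDeriv_smulLeft_field hδ, Finset.sum_add_distrib, hcomm]
  abel

/-- The virial inequality: the commutator with the Laplacian controls the Hessian of the
weight. -/
lemma sum_inner_fieldDeriv_le (hn : 4 ≤ n) {δ : ℝ} (hδ : 0 < δ)
    (f : 𝓢(EuclideanSpace ℝ (Fin n), ℂ)) :
    ∑ j, ∑ k, ⟪toL2 n (SchwartzMap.smulLeftCLM ℂ (fieldDeriv δ j k) (∂_{e k} f)),
      toL2 n (∂_{e j} f)⟫ ≤ -⟪toL2 n (morawetzOp n δ f), toL2 n (Δ f)⟫ := by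
  have hΔ : Δ f = ∑ j : Fin n, ∂_{e j} (∂_{e j} f) := by
    rw [SchwartzMap.laplacian_eq_sum (EuclideanSpace.basisFun (Fin n) ℝ)]
    simp [e]
  have hj : ∀ j, -⟪toL2 n (morawetzOp n δ f), toL2 n (∂_{e j} (∂_{e j} f))⟫ =
      ∑ k, ⟪toL2 n (SchwartzMap.smulLeftCLM ℂ (fieldDeriv δ j k) (∂_{e k} f)),
        toL2 n (∂_{e j} f)⟫ -
      (1 / 2) * ⟪toL2 n (SchwartzMap.smulLeftCLM ℂ (halfDivSnd δ j) f), toL2 n f⟫ := by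
    intro j
    have h : 2 * ⟪toL2 n (SchwartzMap.smulLeftCLM ℂ (fun x => x j * halfDivRad δ x) f),
        toL2 n (∂_{e j} f)⟫ =
        -⟪toL2 n (SchwartzMap.smulLeftCLM ℂ (halfDivSnd δ j) f), toL2 n f⟫ :=
      two_mul_inner_smulLeft_lineDeriv
      ((hasTemperateGrowth_coord j).mul (hasTemperateGrowth_halfDivRad hδ))
      (hasTemperateGrowth_halfDivSnd hδ j) (fderiv_coord_mul_halfDivRad hδ j) f
    rw [← inner_toL2_lineDeriv, lineDeriv_morawetzOp hδ, map_add, map_add, inner_add_left,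
      inner_add_left, inner_morawetzOp_self hδ, map_sum, sum_inner]
    have h' : ⟪toL2 n (SchwartzMap.smulLeftCLM ℂ (fun x => x j * halfDivRad δ x) f),
      toL2 n (∂_{e j} f)⟫ =
        -(1 / 2) * ⟪toL2 n (SchwartzMap.smulLeftCLM ℂ (halfDivSnd δ j) f), toL2 n f⟫ := by
      linarith
    rw [h']
    ring
  have hneg : ∑ j, ⟪toL2 n (SchwartzMap.smulLeftCLM ℂ (halfDivSnd δ j) f), toL2 n f⟫ ≤ 0 := by
    rw [← sum_inner, ← map_sum, inner_toL2]
    refine integral_nonpos fun x => ?_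
    simp only [sum_apply, Pi.zero_apply,
      SchwartzMap.smulLeftCLM_apply_apply (hasTemperateGrowth_halfDivSnd hδ _), ← Finset.sum_smul,
      real_inner_smul_left]
    exact mul_nonpos_of_nonpos_of_nonneg (sum_halfDivSnd_nonpos hδ hn x) real_inner_self_nonneg
  rw [hΔ, map_sum, inner_sum, ← Finset.sum_neg_distrib]
  simp only [hj, Finset.sum_sub_distrib, ← Finset.mul_sum]
  linarith

lemma integrable_inner (f g : 𝓢(EuclideanSpace ℝ (Fin n), ℂ)) :
    Integrable (fun x => ⟪f x, g x⟫) := by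
  refine (L2.integrable_inner (𝕜 := ℝ) (f.toLp 2 volume) (g.toLp 2 volume)).congr ?_
  filter_upwards [f.coeFn_toLp 2 volume, g.coeFn_toLp 2 volume] with x hf hg
  rw [hf, hg]

lemma fderiv_self_eq_sum (f : 𝓢(EuclideanSpace ℝ (Fin n), ℂ)) (x : EuclideanSpace ℝ (Fin n)) :
    fderiv ℝ f x x = ∑ j, x j • ∂_{e j} f x := by
  have h := congrArg (fderiv ℝ f x) ((EuclideanSpace.basisFun (Fin n) ℝ).sum_repr x).symm
  rw [map_sum] at h
  simp only [map_smul, EuclideanSpace.basisFun_repr, EuclideanSpace.basisFun_apply] at h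
  exact h

/-- The regularised angular energy density. -/
noncomputable def angDensity (δ : ℝ) (f : EuclideanSpace ℝ (Fin n) → ℂ)
    (x : EuclideanSpace ℝ (Fin n)) : ℝ :=
  wt δ (-1 / 2) x * gradNormSq f x - wt δ (-3 / 2) x * ‖fderiv ℝ f x x‖ ^ 2

lemma sum_fieldDeriv_inner_eq_angDensity {δ : ℝ} (f : 𝓢(EuclideanSpace ℝ (Fin n), ℂ))
    (x : EuclideanSpace ℝ (Fin n)) :
    ∑ j, ∑ k, fieldDeriv δ j k x * ⟪∂_{e k} f x, ∂_{e j} f x⟫ = angDensity δ f x := by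
  simp only [angDensity, fderiv_self_eq_sum, gradNormSq, ← real_inner_self_eq_norm_sq,
    fieldDeriv, sub_mul, Finset.sum_sub_distrib, ite_mul, zero_mul, Finset.sum_ite_eq,
    Finset.mem_univ, if_true, sum_inner, inner_sum, real_inner_smul_left, real_inner_smul_right,
    Finset.mul_sum]
  congr 1
  rw [Finset.sum_comm]
  refine Finset.sum_congr rfl fun j _ => Finset.sum_congr rfl fun k _ => ?_
  rw [real_inner_comm]
  ring

lemma integral_angDensity {δ : ℝ} (hδ : 0 < δ) (f : 𝓢(EuclideanSpace ℝ (Fin n), ℂ)) :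
    Integrable (angDensity δ f) ∧ ∫ x, angDensity δ f x =
    ∑ j, ∑ k, ⟪toL2 n (SchwartzMap.smulLeftCLM ℂ (fieldDeriv δ j k) (∂_{e k} f)),
      toL2 n (∂_{e j} f)⟫ := by
  have hint : ∀ j k : Fin n,
      Integrable (fun x => fieldDeriv δ j k x * ⟪∂_{e k} f x, ∂_{e j} f x⟫) := by
    intro j k
    have h := integrable_inner (SchwartzMap.smulLeftCLM ℂ (fieldDeriv δ j k) (∂_{e k} f))
      (∂_{e j} f)
    simpa only [SchwartzMap.smulLeftCLM_apply_apply (hasTemperateGrowth_fieldDeriv hδ _ _),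
      real_inner_smul_left] using h
  have hfun : angDensity δ f =
      fun x => ∑ j : Fin n, ∑ k : Fin n, fieldDeriv δ j k x * ⟪∂_{e k} f x, ∂_{e j} f x⟫ := by
    ext x
    rw [sum_fieldDeriv_inner_eq_angDensity]
  refine ⟨hfun ▸ integrable_finsetSum _ fun j _ => integrable_finsetSum _ fun k _ => hint j k, ?_⟩
  rw [hfun, integral_finsetSum _ fun j _ => integrable_finsetSum _ fun k _ => hint j k]
  refine Finset.sum_congr rfl fun j _ => ?_
  rw [integral_finsetSum _ fun k _ => hint j k]
  refine Finset.sum_congr rfl fun k _ => ?_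
  simp only [inner_toL2, SchwartzMap.smulLeftCLM_apply_apply (hasTemperateGrowth_fieldDeriv hδ _ _),
    real_inner_smul_left]

lemma integral_angDensity_le (hn : 4 ≤ n) {δ : ℝ} (hδ : 0 < δ)
    (f : 𝓢(EuclideanSpace ℝ (Fin n), ℂ)) :
    ∫ x, angDensity δ f x ≤ -⟪toL2 n (morawetzOp n δ f), toL2 n (Δ f)⟫ := by
  rw [(integral_angDensity hδ f).2]
  exact sum_inner_fieldDeriv_le hn hδ f

lemma fourier_fourierMultiplier {𝕜 : Type*} [RCLike 𝕜] [NormedSpace 𝕜 ℂ] [SMulCommClass ℂ 𝕜 ℂ]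
    {m : EuclideanSpace ℝ (Fin n) → 𝕜} (hm : m.HasTemperateGrowth)
    (f : 𝓢(EuclideanSpace ℝ (Fin n), ℂ)) (ξ : EuclideanSpace ℝ (Fin n)) :
    𝓕 (SchwartzMap.fourierMultiplierCLM ℂ m f) ξ = m ξ • 𝓕 f ξ := by
  rw [SchwartzMap.fourierMultiplierCLM_apply, FourierTransform.fourier_fourierInv_eq,
    SchwartzMap.smulLeftCLM_apply_apply hm]

lemma fourier_injective {f g : 𝓢(EuclideanSpace ℝ (Fin n), ℂ)}
    (h : ∀ ξ, 𝓕 f ξ = 𝓕 g ξ) : f = g := by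
  have h' := congrArg (fun u : 𝓢(EuclideanSpace ℝ (Fin n), ℂ) =>
    (𝓕⁻ u : 𝓢(EuclideanSpace ℝ (Fin n), ℂ)))
    (SchwartzMap.ext h : (𝓕 f : 𝓢(EuclideanSpace ℝ (Fin n), ℂ)) = 𝓕 g)
  simpa only [FourierTransform.fourierInv_fourier_eq] using h'

lemma norm_fourier_lineDeriv (k : Fin n) (f : 𝓢(EuclideanSpace ℝ (Fin n), ℂ))
    (ξ : EuclideanSpace ℝ (Fin n)) :
    ‖𝓕 (∂_{e k} f) ξ‖ = 2 * Real.pi * |ξ k| * ‖𝓕 f ξ‖ := by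
  have hm : (fun ξ : EuclideanSpace ℝ (Fin n) => ⟪ξ, e k⟫).HasTemperateGrowth := by fun_prop
  rw [SchwartzMap.lineDeriv_eq_fourierMultiplierCLM, FourierTransform.fourier_smul, smul_apply,
    fourier_fourierMultiplier hm, norm_smul, norm_smul]
  simp [EuclideanSpace.inner_single_right, Real.pi_pos.le, mul_assoc]

lemma fourier_laplacian (f : 𝓢(EuclideanSpace ℝ (Fin n), ℂ)) (ξ : EuclideanSpace ℝ (Fin n)) :
    𝓕 (Δ f) ξ = (-‖(2 * Real.pi) • ξ‖ ^ 2 : ℝ) • 𝓕 f ξ := by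
  have hm : ((‖·‖ ^ 2 : EuclideanSpace ℝ (Fin n) → ℝ)).HasTemperateGrowth := by fun_prop
  rw [SchwartzMap.laplacian_eq_fourierMultiplierCLM, FourierTransform.fourier_smul, smul_apply,
    fourier_fourierMultiplier hm, smul_smul, norm_smul, Real.norm_of_nonneg (by positivity)]
  congr 1
  simp
  ring

/-- The symbol `(1 + |2πξ|²)^p`. -/
noncomputable def besselSymbol (p : ℝ) (ξ : EuclideanSpace ℝ (Fin n)) : ℝ :=
  (1 + ‖(2 * Real.pi) • ξ‖ ^ 2) ^ p

lemma hasTemperateGrowth_besselSymbol (p : ℝ) :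
    (besselSymbol (n := n) p).HasTemperateGrowth :=
  (Function.hasTemperateGrowth_one_add_norm_sq_rpow (EuclideanSpace ℝ (Fin n)) p).comp
    ((2 * Real.pi) • ContinuousLinearMap.id ℝ (EuclideanSpace ℝ (Fin n))).hasTemperateGrowth

lemma besselSymbol_pos (p : ℝ) (ξ : EuclideanSpace ℝ (Fin n)) : 0 < besselSymbol p ξ := by
  unfold besselSymbol
  positivity

/-- The Bessel potential `(1 - Δ)^p`. -/
noncomputable def bessel (n : ℕ) (p : ℝ) :
    𝓢(EuclideanSpace ℝ (Fin n), ℂ) →ₗ[ℝ] 𝓢(EuclideanSpace ℝ (Fin n), ℂ) :=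
  (SchwartzMap.fourierMultiplierCLM ℂ (besselSymbol (n := n) p)).toLinearMap

lemma fourier_bessel (p : ℝ) (f : 𝓢(EuclideanSpace ℝ (Fin n), ℂ))
    (ξ : EuclideanSpace ℝ (Fin n)) : 𝓕 (bessel n p f) ξ = besselSymbol p ξ • 𝓕 f ξ :=
  fourier_fourierMultiplier (hasTemperateGrowth_besselSymbol p) f ξ

lemma norm_fourier_bessel (p : ℝ) (f : 𝓢(EuclideanSpace ℝ (Fin n), ℂ))
    (ξ : EuclideanSpace ℝ (Fin n)) : ‖𝓕 (bessel n p f) ξ‖ = besselSymbol p ξ * ‖𝓕 f ξ‖ := by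
  rw [fourier_bessel, norm_smul, Real.norm_of_nonneg (besselSymbol_pos p ξ).le]

lemma bessel_bessel (p q : ℝ) (f : 𝓢(EuclideanSpace ℝ (Fin n), ℂ)) :
    bessel n p (bessel n q f) = bessel n (p + q) f := by
  refine fourier_injective fun ξ => ?_
  simp only [fourier_bessel, smul_smul, besselSymbol]
  rw [Real.rpow_add (by positivity)]

lemma bessel_zero (f : 𝓢(EuclideanSpace ℝ (Fin n), ℂ)) : bessel n 0 f = f := by
  refine fourier_injective fun ξ => ?_
  simp [fourier_bessel, besselSymbol]

lemma inner_bessel (p : ℝ) (f g : 𝓢(EuclideanSpace ℝ (Fin n), ℂ)) :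
    ⟪toL2 n (bessel n p f), toL2 n g⟫ = ⟪toL2 n f, toL2 n (bessel n p g)⟫ := by
  rw [← inner_toL2_fourier, ← inner_toL2_fourier f, inner_toL2, inner_toL2]
  congr with ξ
  rw [fourier_bessel, fourier_bessel, real_inner_smul_left, real_inner_smul_right]

lemma norm_lineDeriv_le (k : Fin n) (f : 𝓢(EuclideanSpace ℝ (Fin n), ℂ)) :
    ‖toL2 n (∂_{e k} f)‖ ≤ ‖toL2 n (bessel n (1 / 2) f)‖ := by
  rw [← one_mul ‖toL2 n (bessel n (1 / 2) f)‖]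
  refine norm_toL2_le_of_fourier fun ξ => ?_
  rw [norm_fourier_lineDeriv, norm_fourier_bessel, one_mul, besselSymbol, ← Real.sqrt_eq_rpow]
  gcongr
  refine Real.le_sqrt_of_sq_le ?_
  have h : |ξ k| ≤ ‖ξ‖ := PiLp.norm_apply_le ξ k
  rw [norm_smul, Real.norm_of_nonneg (by positivity)]
  have : (2 * Real.pi * |ξ k|) ^ 2 ≤ (2 * Real.pi * ‖ξ‖) ^ 2 := by gcongr
  linarith

lemma norm_coord_mul_wt_le {δ : ℝ} (hδ : 0 < δ) (k : Fin n) (x : EuclideanSpace ℝ (Fin n)) :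
    ‖x k‖ * wt δ (-1 / 2) x ≤ 1 := by
  have h : ‖x k‖ ≤ (δ + ‖x‖ ^ 2) ^ (1 / 2 : ℝ) := by
    rw [← Real.sqrt_eq_rpow]
    refine (PiLp.norm_apply_le x k).trans (Real.le_sqrt_of_sq_le ?_)
    linarith
  calc ‖x k‖ * wt δ (-1 / 2) x ≤ wt δ (1 / 2) x * wt δ (-1 / 2) x :=
        mul_le_mul_of_nonneg_right h (wt_pos hδ _ x).le
    _ = 1 := by rw [wt_mul_wt hδ]; norm_num [wt]

/-- A regularised Hardy inequality. -/
lemma norm_wt_smul_le (hn : 4 ≤ n) {δ : ℝ} (hδ : 0 < δ)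
    (f : 𝓢(EuclideanSpace ℝ (Fin n), ℂ)) :
    ‖toL2 n (SchwartzMap.smulLeftCLM ℂ (wt δ (-1 / 2)) f)‖ ≤
      2 * n * ‖toL2 n (bessel n (1 / 2) f)‖ := by
  set g := SchwartzMap.smulLeftCLM ℂ (wt δ (-1 / 2)) f with hg
  have hφ : ∀ k : Fin n, (fun x => x k * wt δ (-1) x).HasTemperateGrowth := fun k =>
    (hasTemperateGrowth_coord k).mul (hasTemperateGrowth_wt hδ _)
  have hφ' : ∀ k : Fin n,
      (fun x => wt δ (-1) x - x k * (x k * (2 * wt δ (-2) x))).HasTemperateGrowth := fun k =>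
    (hasTemperateGrowth_wt hδ _).sub ((hasTemperateGrowth_coord k).mul
      ((hasTemperateGrowth_coord k).mul
        ((Function.HasTemperateGrowth.const _).mul (hasTemperateGrowth_wt hδ _))))
  have hder : ∀ (k : Fin n) (x : EuclideanSpace ℝ (Fin n)),
      fderiv ℝ (fun x : EuclideanSpace ℝ (Fin n) => x k * wt δ (-1) x) x (e k) =
        wt δ (-1) x - x k * (x k * (2 * wt δ (-2) x)) := by
    intro k x
    rw [fderiv_coord_mul (hasFDerivAt_wt hδ (-1) x).differentiableAt, fderiv_wt hδ]
    norm_num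
    ring
  have hk := fun k => two_mul_inner_smulLeft_lineDeriv (hφ k) (hφ' k) (hder k) f
  have hsum : ‖toL2 n g‖ ^ 2 ≤ ∑ k : Fin n, ⟪toL2 n (SchwartzMap.smulLeftCLM ℂ
      (fun x => wt δ (-1) x - x k * (x k * (2 * wt δ (-2) x))) f), toL2 n f⟫ := by
    rw [← real_inner_self_eq_norm_sq, ← sum_inner, ← map_sum, inner_toL2, inner_toL2]
    refine integral_mono (integrable_inner _ _) (integrable_inner _ _) fun x => ?_
    simp only [hg, sum_apply, SchwartzMap.smulLeftCLM_apply_apply (hφ' _),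
      SchwartzMap.smulLeftCLM_apply_apply (hasTemperateGrowth_wt hδ _), ← Finset.sum_smul,
      real_inner_smul_left, real_inner_smul_right]
    rw [← mul_assoc, wt_mul_wt hδ]
    refine mul_le_mul_of_nonneg_right ?_ real_inner_self_nonneg
    have h1 : ∑ k, x k * (x k * (2 * wt δ (-2) x)) = ‖x‖ ^ 2 * (2 * wt δ (-2) x) := by
      rw [← sum_coord_sq, Finset.sum_mul]
      exact Finset.sum_congr rfl fun k _ => by ring
    have h2 := mul_wt_sub_one hδ (-1) x
    norm_num at h2
    have h3 : (4 : ℝ) ≤ n := by exact_mod_cast hn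
    rw [Finset.sum_sub_distrib, h1, Finset.sum_const, Finset.card_univ, Fintype.card_fin,
      nsmul_eq_mul]
    norm_num
    nlinarith [wt_pos hδ (-1) x, mul_pos hδ (wt_pos hδ (-2) x)]
  have hle : ∀ k : Fin n, -(2 * ⟪toL2 n (SchwartzMap.smulLeftCLM ℂ
      (fun x => x k * wt δ (-1) x) f), toL2 n (∂_{e k} f)⟫) ≤
      2 * (‖toL2 n g‖ * ‖toL2 n (bessel n (1 / 2) f)‖) := by
    intro k
    have h1 : ‖toL2 n (SchwartzMap.smulLeftCLM ℂ (fun x => x k * wt δ (-1) x) f)‖ ≤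
        1 * ‖toL2 n g‖ := by
      refine norm_toL2_le_mul fun x => ?_
      rw [hg, SchwartzMap.smulLeftCLM_apply_apply (hφ k),
        SchwartzMap.smulLeftCLM_apply_apply (hasTemperateGrowth_wt hδ _), norm_smul, norm_smul,
        one_mul]
      gcongr
      have hw : wt δ (-1) x = wt δ (-1 / 2) x * wt δ (-1 / 2) x := by
        rw [wt_mul_wt hδ]
        norm_num
      rw [norm_mul, Real.norm_of_nonneg (wt_pos hδ _ x).le, Real.norm_of_nonneg (wt_pos hδ _ x).le,
        hw, ← mul_assoc]
      refine mul_le_of_le_one_left (wt_pos hδ _ x).le ?_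
      exact norm_coord_mul_wt_le hδ k x
    rw [one_mul] at h1
    have h2 := abs_real_inner_le_norm (toL2 n (SchwartzMap.smulLeftCLM ℂ
      (fun x => x k * wt δ (-1) x) f)) (toL2 n (∂_{e k} f))
    have h3 := mul_le_mul h1 (norm_lineDeriv_le k f) (norm_nonneg _) (norm_nonneg _)
    linarith [neg_abs_le ⟪toL2 n (SchwartzMap.smulLeftCLM ℂ
      (fun x => x k * wt δ (-1) x) f), toL2 n (∂_{e k} f)⟫]
  have htot : ‖toL2 n g‖ ^ 2 ≤ 2 * n * ‖toL2 n (bessel n (1 / 2) f)‖ * ‖toL2 n g‖ := by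
    refine hsum.trans ?_
    calc _ ≤ ∑ _k : Fin n, 2 * (‖toL2 n g‖ * ‖toL2 n (bessel n (1 / 2) f)‖) :=
          Finset.sum_le_sum fun k _ => by linarith [hle k, hk k]
      _ = _ := by simp; ring
  rcases (norm_nonneg (toL2 n g)).eq_or_lt with h0 | h0
  · rw [← h0]
    positivity
  · exact le_of_mul_le_mul_right (by linarith) h0

lemma norm_morawetzOp_le (hn : 4 ≤ n) {δ : ℝ} (hδ : 0 < δ)
    (f : 𝓢(EuclideanSpace ℝ (Fin n), ℂ)) :
    ‖toL2 n (morawetzOp n δ f)‖ ≤ (n + n ^ 2) * ‖toL2 n (bessel n (1 / 2) f)‖ := by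
  have h1 : ∀ k : Fin n, ‖toL2 n (SchwartzMap.smulLeftCLM ℂ (field δ k) (∂_{e k} f))‖ ≤
      ‖toL2 n (bessel n (1 / 2) f)‖ := by
    intro k
    refine le_trans ?_ (norm_lineDeriv_le k f)
    rw [← one_mul ‖toL2 n (∂_{e k} f)‖]
    refine norm_toL2_le_mul fun x => ?_
    rw [SchwartzMap.smulLeftCLM_apply_apply (hasTemperateGrowth_field hδ k), norm_smul]
    gcongr
    rw [field, norm_mul, Real.norm_of_nonneg (wt_pos hδ _ x).le]
    exact norm_coord_mul_wt_le hδ k x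
  have h2 : ‖toL2 n (SchwartzMap.smulLeftCLM ℂ (halfDiv δ) f)‖ ≤
      n / 2 * ‖toL2 n (SchwartzMap.smulLeftCLM ℂ (wt δ (-1 / 2)) f)‖ := by
    refine norm_toL2_le_mul fun x => ?_
    rw [SchwartzMap.smulLeftCLM_apply_apply (hasTemperateGrowth_halfDiv hδ),
      SchwartzMap.smulLeftCLM_apply_apply (hasTemperateGrowth_wt hδ _), norm_smul, norm_smul,
      ← mul_assoc]
    gcongr
    have hn1 : (4 : ℝ) ≤ n := by exact_mod_cast hn
    have p1 := wt_pos hδ (-1 / 2) x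
    have p3 := wt_pos hδ (-3 / 2) x
    have h := mul_wt_sub_one hδ (-1 / 2) x
    norm_num at h
    have hpos : 0 ≤ halfDiv δ x := by
      unfold halfDiv
      have : (0 : ℝ) ≤ ((n : ℝ) - 1) / 2 := by linarith
      positivity
    rw [Real.norm_of_nonneg hpos, Real.norm_of_nonneg p1.le, halfDiv]
    norm_num
    nlinarith [mul_nonneg (sq_nonneg ‖x‖) p3.le]
  have h3 := norm_wt_smul_le hn hδ f
  rw [morawetzOp_apply, map_add, map_sum]
  calc _ ≤ ∑ k : Fin n, ‖toL2 n (SchwartzMap.smulLeftCLM ℂ (field δ k) (∂_{e k} f))‖ +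
        ‖toL2 n (SchwartzMap.smulLeftCLM ℂ (halfDiv δ) f)‖ :=
          (norm_add_le _ _).trans (by gcongr; exact norm_sum_le _ _)
    _ ≤ ∑ _k : Fin n, ‖toL2 n (bessel n (1 / 2) f)‖ +
        n / 2 * (2 * n * ‖toL2 n (bessel n (1 / 2) f)‖) := by
          gcongr
          · exact h1 _
          · exact h2.trans (by gcongr)
    _ = _ := by simp; ring

/-- The symmetric operator `-i P`. -/
noncomputable def morawetzSymm (n : ℕ) (δ : ℝ) :
    𝓢(EuclideanSpace ℝ (Fin n), ℂ) →ₗ[ℝ] 𝓢(EuclideanSpace ℝ (Fin n), ℂ) where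
  toFun f := -(Complex.I • morawetzOp n δ f)
  map_add' f g := by rw [map_add, smul_add, neg_add]
  map_smul' c f := by rw [map_smul, RingHom.id_apply, smul_neg, smul_comm]

lemma morawetzOp_I_smul {δ : ℝ} (hδ : 0 < δ) (f : 𝓢(EuclideanSpace ℝ (Fin n), ℂ)) :
    morawetzOp n δ (Complex.I • f) = Complex.I • morawetzOp n δ f := by
  ext x
  simp only [morawetzOp_apply, LineDeriv.lineDerivOp_smul, add_apply, smul_apply, sum_apply,
    SchwartzMap.smulLeftCLM_apply_apply (hasTemperateGrowth_field hδ _),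
    SchwartzMap.smulLeftCLM_apply_apply (hasTemperateGrowth_halfDiv hδ), smul_add, Finset.smul_sum,
    smul_comm _ Complex.I]

lemma inner_morawetzSymm {δ : ℝ} (hδ : 0 < δ) (f g : 𝓢(EuclideanSpace ℝ (Fin n), ℂ)) :
    ⟪toL2 n (morawetzSymm n δ f), toL2 n g⟫ = ⟪toL2 n f, toL2 n (morawetzSymm n δ g)⟫ := by
  change ⟪toL2 n (-(Complex.I • morawetzOp n δ f)), toL2 n g⟫ =
    ⟪toL2 n f, toL2 n (-(Complex.I • morawetzOp n δ g))⟫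
  rw [map_neg, map_neg, inner_neg_left, inner_neg_right, inner_toL2_I_smul, inner_morawetzOp hδ,
    morawetzOp_I_smul hδ, neg_neg]

lemma norm_morawetzSymm (δ : ℝ) (f : 𝓢(EuclideanSpace ℝ (Fin n), ℂ)) :
    ‖toL2 n (morawetzSymm n δ f)‖ = ‖toL2 n (morawetzOp n δ f)‖ := by
  change ‖toL2 n (-(Complex.I • morawetzOp n δ f))‖ = _
  rw [← sq_eq_sq₀ (norm_nonneg _) (norm_nonneg _), norm_sq_toL2, norm_sq_toL2]
  simp

lemma abs_inner_morawetzSymm_le (hn : 4 ≤ n) {δ : ℝ} (hδ : 0 < δ)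
    (f : 𝓢(EuclideanSpace ℝ (Fin n), ℂ)) :
    |⟪toL2 n f, toL2 n (morawetzSymm n δ f)⟫| ≤
      (n + n ^ 2) * ‖toL2 n (bessel n (1 / 4) f)‖ ^ 2 := by
  have hC : (0 : ℝ) < n + n ^ 2 := by
    have : (0 : ℝ) < n := by exact_mod_cast (by omega : 0 < n)
    positivity
  refine abs_inner_le_of_norm_le (J := (toL2 n).toLinearMap) (A := morawetzSymm n δ)
    (L := bessel n (1 / 4)) (L' := bessel n (-1 / 4)) hC (inner_morawetzSymm hδ) (inner_bessel _)
    (fun f => ?_) (fun f => ?_) (fun f => ?_) (fun f => ?_) f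
  · rw [bessel_bessel, show (1 / 4 : ℝ) + -1 / 4 = 0 by norm_num, bessel_zero]
  · rw [bessel_bessel, show (-1 / 4 : ℝ) + 1 / 4 = 0 by norm_num, bessel_zero]
  · refine (norm_toL2_le_of_fourier (c := 1) fun ξ => ?_).trans_eq (one_mul _)
    rw [norm_fourier_bessel]
    gcongr
    exact Real.rpow_le_one_of_one_le_of_nonpos (by simp) (by norm_num)
  · change ‖toL2 n (morawetzSymm n δ f)‖ ≤ (n + n ^ 2) * ‖toL2 n (bessel n _ (bessel n _ f))‖
    rw [norm_morawetzSymm, bessel_bessel, show (1 / 4 : ℝ) + 1 / 4 = 1 / 2 by norm_num]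
    exact norm_morawetzOp_le hn hδ f

/-- The symbol `e^{-it|2πξ|²}` of the Schrödinger flow. -/
noncomputable def flowSymbol (t : ℝ) (ξ : EuclideanSpace ℝ (Fin n)) : ℂ :=
  Complex.exp (((-(t * ‖(2 * Real.pi) • ξ‖ ^ 2) : ℝ) : ℂ) * Complex.I)

lemma hasTemperateGrowth_exp_mul_I :
    (fun s : ℝ => Complex.exp (s * Complex.I)).HasTemperateGrowth := by
  have hd : ∀ k : ℕ, iteratedDeriv k (fun s : ℝ => Complex.exp (s * Complex.I)) =
      fun s : ℝ => Complex.I ^ k * Complex.exp (s * Complex.I) := by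
    intro k
    induction k with
    | zero => simp
    | succ k ih =>
      rw [iteratedDeriv_succ, ih]
      ext s
      have h1 : HasDerivAt (fun s : ℝ => (s : ℂ) * Complex.I) Complex.I s := by
        simpa using (Complex.ofRealCLM.hasDerivAt (x := s)).mul_const Complex.I
      have h := (h1.cexp.const_mul (Complex.I ^ k)).deriv
      rw [h]
      ring
  refine ⟨(Complex.ofRealCLM.contDiff.mul contDiff_const).cexp, fun k => ⟨0, 1, fun s => ?_⟩⟩
  rw [norm_iteratedFDeriv_eq_norm_iteratedDeriv, hd]
  simp

lemma hasTemperateGrowth_flowSymbol (t : ℝ) : (flowSymbol (n := n) t).HasTemperateGrowth := by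
  have h : (fun ξ : EuclideanSpace ℝ (Fin n) =>
      -(t * ‖(2 * Real.pi) • ξ‖ ^ 2)).HasTemperateGrowth :=
    ((Function.HasTemperateGrowth.const t).mul
      ((Function.hasTemperateGrowth_norm_sq (EuclideanSpace ℝ (Fin n))).comp
        ((2 * Real.pi) •
          ContinuousLinearMap.id ℝ (EuclideanSpace ℝ (Fin n))).hasTemperateGrowth)).neg
  exact hasTemperateGrowth_exp_mul_I.comp h

lemma norm_flowSymbol (t : ℝ) (ξ : EuclideanSpace ℝ (Fin n)) : ‖flowSymbol t ξ‖ = 1 :=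
  Complex.norm_exp_ofReal_mul_I _

/-- The free Schrödinger flow on the Schwartz space. -/
noncomputable def flow (t : ℝ) (f : 𝓢(EuclideanSpace ℝ (Fin n), ℂ)) :
    𝓢(EuclideanSpace ℝ (Fin n), ℂ) :=
  SchwartzMap.fourierMultiplierCLM ℂ (flowSymbol t) f

lemma fourier_flow (t : ℝ) (f : 𝓢(EuclideanSpace ℝ (Fin n), ℂ)) (ξ : EuclideanSpace ℝ (Fin n)) :
    𝓕 (flow t f) ξ = flowSymbol t ξ * 𝓕 f ξ :=
  fourier_fourierMultiplier (hasTemperateGrowth_flowSymbol t) f ξ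

lemma norm_bessel_flow (p t : ℝ) (f : 𝓢(EuclideanSpace ℝ (Fin n), ℂ)) :
    ‖toL2 n (bessel n p (flow t f))‖ = ‖toL2 n (bessel n p f)‖ := by
  have h : ∀ ξ, ‖𝓕 (bessel n p (flow t f)) ξ‖ = ‖𝓕 (bessel n p f) ξ‖ := fun ξ => by
    rw [norm_fourier_bessel, norm_fourier_bessel, fourier_flow, norm_mul, norm_flowSymbol, one_mul]
  exact le_antisymm
    ((norm_toL2_le_of_fourier (c := 1) fun ξ => by rw [h, one_mul]).trans_eq (one_mul _))
    ((norm_toL2_le_of_fourier (c := 1) fun ξ => by rw [h, one_mul]).trans_eq (one_mul _))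

lemma norm_exp_mul_I_sub_le (s : ℝ) :
    ‖Complex.exp (s * Complex.I) - 1 - s * Complex.I‖ ≤ 2 * s ^ 2 := by
  have hs : ‖(s : ℂ) * Complex.I‖ = |s| := by simp
  rcases le_or_gt |s| 1 with h | h
  · have h1 := Complex.norm_exp_sub_one_sub_id_le (x := s * Complex.I) (by rw [hs]; exact h)
    rw [hs, sq_abs] at h1
    nlinarith [sq_nonneg s]
  · have h1 : ‖Complex.exp (s * Complex.I) - 1‖ ≤ |s| := by
      have := Real.norm_exp_I_mul_ofReal_sub_one_le (x := s)
      rwa [mul_comm, Real.norm_eq_abs] at this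
    calc _ ≤ |s| + |s| := (norm_sub_le _ _).trans (by rw [hs]; gcongr)
      _ ≤ 2 * s ^ 2 := by rw [← sq_abs]; nlinarith

lemma fourier_sub (f g : 𝓢(EuclideanSpace ℝ (Fin n), ℂ)) : 𝓕 (f - g) = 𝓕 f - 𝓕 g :=
  map_sub (FourierTransform.fourierCLM ℂ 𝓢(EuclideanSpace ℝ (Fin n), ℂ)) f g

lemma norm_flow_remainder_le (t h : ℝ) (f : 𝓢(EuclideanSpace ℝ (Fin n), ℂ)) :
    ‖toL2 n (bessel n (1 / 2)
      (flow (t + h) f - flow t f - h • (Complex.I • Δ (flow t f))))‖ ≤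
      2 * h ^ 2 * ‖toL2 n (bessel n (5 / 2) f)‖ := by
  refine norm_toL2_le_of_fourier fun ξ => ?_
  have hF : 𝓕 (flow (t + h) f - flow t f - h • (Complex.I • Δ (flow t f))) ξ =
      flowSymbol t ξ * (Complex.exp (((-(h * ‖(2 * Real.pi) • ξ‖ ^ 2) : ℝ) : ℂ) * Complex.I) - 1 -
        ((-(h * ‖(2 * Real.pi) • ξ‖ ^ 2) : ℝ) : ℂ) * Complex.I) * 𝓕 f ξ := by
    have hadd : flowSymbol (t + h) ξ = flowSymbol t ξ *
        Complex.exp (((-(h * ‖(2 * Real.pi) • ξ‖ ^ 2) : ℝ) : ℂ) * Complex.I) := by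
      rw [flowSymbol, flowSymbol, ← Complex.exp_add]
      congr 1
      push_cast
      ring
    rw [fourier_sub, fourier_sub, FourierTransform.fourier_smul,
      FourierTransform.fourier_smul, sub_apply, sub_apply, smul_apply, smul_apply, fourier_flow,
      fourier_laplacian, fourier_flow, hadd]
    simp only [Complex.real_smul, smul_eq_mul]
    push_cast
    ring
  rw [norm_fourier_bessel, norm_fourier_bessel, hF, norm_mul, norm_mul, norm_flowSymbol, one_mul]
  have h1 := norm_exp_mul_I_sub_le (-(h * ‖(2 * Real.pi) • ξ‖ ^ 2))
  have h2 : besselSymbol (1 / 2) ξ * (‖(2 * Real.pi) • ξ‖ ^ 2) ^ 2 ≤ besselSymbol (5 / 2) ξ := by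
    rw [show (5 / 2 : ℝ) = 1 / 2 + (2 : ℕ) by norm_num, besselSymbol, besselSymbol,
      Real.rpow_add (by positivity), Real.rpow_natCast]
    gcongr
    linarith
  calc _ ≤ besselSymbol (1 / 2) ξ * (2 * (-(h * ‖(2 * Real.pi) • ξ‖ ^ 2)) ^ 2 * ‖𝓕 f ξ‖) := by
        gcongr
        exact (besselSymbol_pos _ ξ).le
    _ = 2 * h ^ 2 * ((besselSymbol (1 / 2) ξ * (‖(2 * Real.pi) • ξ‖ ^ 2) ^ 2) * ‖𝓕 f ξ‖) := by ring
    _ ≤ _ := by gcongr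

lemma hasDerivAt_flow {B : 𝓢(EuclideanSpace ℝ (Fin n), ℂ) →ₗ[ℝ] 𝓢(EuclideanSpace ℝ (Fin n), ℂ)}
    {C : ℝ} (hB : ∀ f, ‖toL2 n (B f)‖ ≤ C * ‖toL2 n (bessel n (1 / 2) f)‖) (hC : 0 ≤ C)
    (f : 𝓢(EuclideanSpace ℝ (Fin n), ℂ)) (t : ℝ) :
    HasDerivAt (fun t => toL2 n (B (flow t f))) (toL2 n (B (Complex.I • Δ (flow t f)))) t := by
  rw [hasDerivAt_iff_isLittleO_nhds_zero]
  refine Asymptotics.IsBigO.trans_isLittleO (g := fun h : ℝ => h ^ 2) ?_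
    (Asymptotics.isLittleO_pow_id one_lt_two)
  refine Asymptotics.IsBigO.of_bound (C * (2 * ‖toL2 n (bessel n (5 / 2) f)‖))
    (.of_forall fun h => ?_)
  rw [← map_smul, ← map_smul, ← map_sub, ← map_sub, ← map_sub, ← map_sub]
  refine (hB _).trans ?_
  rw [mul_assoc]
  gcongr
  refine (norm_flow_remainder_le t h f).trans_eq ?_
  rw [Real.norm_of_nonneg (sq_nonneg h)]
  ring

/-- The derivative of the Morawetz functional along the flow. -/
lemma hasDerivAt_morawetz (hn : 4 ≤ n) {δ : ℝ} (hδ : 0 < δ)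
    (f : 𝓢(EuclideanSpace ℝ (Fin n), ℂ)) (t : ℝ) :
    HasDerivAt (fun t => ⟪toL2 n (flow t f), toL2 n (morawetzSymm n δ (flow t f))⟫)
      (2 * -⟪toL2 n (morawetzOp n δ (flow t f)), toL2 n (Δ (flow t f))⟫) t := by
  have h1 := hasDerivAt_flow (B := LinearMap.id) (C := 1) (fun f => by
    refine norm_toL2_le_of_fourier fun ξ => ?_
    rw [norm_fourier_bessel, one_mul, LinearMap.id_apply]
    refine le_mul_of_one_le_left (norm_nonneg _) ?_
    exact Real.one_le_rpow (by simp) (by norm_num)) zero_le_one f t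
  have h2 := hasDerivAt_flow (B := morawetzSymm n δ) (C := n + n ^ 2) (fun f => by
    rw [norm_morawetzSymm]
    exact norm_morawetzOp_le hn hδ f) (by positivity) f t
  convert! h1.inner ℝ h2 using 1
  simp only [LinearMap.id_apply]
  rw [← inner_morawetzSymm hδ, real_inner_comm (toL2 n (morawetzSymm n δ (flow t f))), ← two_mul]
  change _ = 2 * ⟪toL2 n (-(Complex.I • morawetzOp n δ (flow t f))), _⟫
  rw [map_neg, inner_neg_left, inner_toL2_I_smul, smul_smul, Complex.I_mul_I, neg_smul, one_smul,
    map_neg, inner_neg_right]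
  ring

lemma fourierT_eq (u : 𝓢(EuclideanSpace ℝ (Fin n), ℂ)) (ξ : EuclideanSpace ℝ (Fin n)) :
    fourierT u ((2 * Real.pi) • ξ) = ((2 * Real.pi) ^ (-(n : ℝ) / 2) : ℝ) * 𝓕 u ξ := by
  rw [fourierT, SchwartzMap.fourier_coe, Real.fourier_eq']
  congr with x
  rw [smul_eq_mul, real_inner_smul_right]
  congr 2
  push_cast
  ring

lemma integral_eq_integral_smul {F : Type*} [NormedAddCommGroup F] [NormedSpace ℝ F]
    (g : EuclideanSpace ℝ (Fin n) → F) :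
    ∫ ξ, g ξ = (2 * Real.pi) ^ n • ∫ ξ, g ((2 * Real.pi) • ξ) := by
  rw [Measure.integral_comp_smul, finrank_euclideanSpace_fin, abs_of_nonneg (by positivity),
    smul_inv_smul₀ (by positivity)]

lemma two_pi_rpow_mul_self :
    (2 * Real.pi) ^ n * ((2 * Real.pi) ^ (-(n : ℝ) / 2) * (2 * Real.pi) ^ (-(n : ℝ) / 2)) = 1 := by
  rw [← Real.rpow_add (by positivity), ← Real.rpow_natCast, ← Real.rpow_add (by positivity)]
  ring_nf
  simp

lemma schrodSol_eq (f : 𝓢(EuclideanSpace ℝ (Fin n), ℂ)) (t : ℝ) : schrodSol f t = flow t f := by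
  ext x
  rw [flow, SchwartzMap.fourierMultiplierCLM_apply, SchwartzMap.fourierInv_coe, Real.fourierInv_eq',
    schrodSol, integral_eq_integral_smul, Complex.real_smul, ← mul_assoc, ← integral_const_mul]
  congr with ξ
  rw [fourierT_eq, SchwartzMap.smulLeftCLM_apply_apply (hasTemperateGrowth_flowSymbol t),
    smul_eq_mul, smul_eq_mul, flowSymbol, real_inner_smul_right]
  have h : ((2 * Real.pi) ^ (-(n : ℝ) / 2) : ℝ) * (((2 * Real.pi) ^ n : ℝ) : ℂ) *
      ((2 * Real.pi) ^ (-(n : ℝ) / 2) : ℝ) = 1 := by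
    rw [← Complex.ofReal_mul, ← Complex.ofReal_mul, ← Complex.ofReal_one,
      ← two_pi_rpow_mul_self (n := n)]
    congr 1
    ring
  have h1 : Complex.exp (Complex.I * ((2 * Real.pi * ⟪x, ξ⟫ : ℝ) : ℂ)) =
      Complex.exp (((2 * Real.pi * ⟪ξ, x⟫ : ℝ) : ℂ) * Complex.I) := by
    rw [mul_comm, real_inner_comm]
  have h2 : Complex.exp (-Complex.I * (t : ℂ) * ((‖(2 * Real.pi) • ξ‖ ^ 2 : ℝ) : ℂ)) =
      Complex.exp (((-(t * ‖(2 * Real.pi) • ξ‖ ^ 2) : ℝ) : ℂ) * Complex.I) := by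
    congr 1
    push_cast
    ring
  rw [h1, h2]
  linear_combination (Complex.exp (((2 * Real.pi * ⟪ξ, x⟫ : ℝ) : ℂ) * Complex.I) *
    Complex.exp (((-(t * ‖(2 * Real.pi) • ξ‖ ^ 2) : ℝ) : ℂ) * Complex.I) * 𝓕 f ξ) * h

lemma sobolevNormSq_eq (f : 𝓢(EuclideanSpace ℝ (Fin n), ℂ)) :
    sobolevNormSq (1 / 2) f = ‖toL2 n (bessel n (1 / 4) f)‖ ^ 2 := by
  rw [← norm_toL2_fourier, norm_sq_toL2, sobolevNormSq, integral_eq_integral_smul, smul_eq_mul,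
    ← integral_const_mul]
  congr with ξ
  have h := two_pi_rpow_mul_self (n := n)
  have hb : besselSymbol (1 / 4) ξ ^ 2 = (1 + ‖(2 * Real.pi) • ξ‖ ^ 2) ^ (1 / 2 : ℝ) := by
    rw [besselSymbol, ← Real.rpow_natCast, ← Real.rpow_mul (by positivity)]
    norm_num
  rw [fourierT_eq, norm_fourier_bessel, mul_pow (besselSymbol _ _), hb, norm_mul, Complex.norm_real,
    Real.norm_of_nonneg (by positivity)]
  linear_combination ((1 + ‖(2 * Real.pi) • ξ‖ ^ 2) ^ (1 / 2 : ℝ) * ‖𝓕 f ξ‖ ^ 2) * h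

lemma norm_fderiv_self_sq_le (f : 𝓢(EuclideanSpace ℝ (Fin n), ℂ))
    (x : EuclideanSpace ℝ (Fin n)) :
    ‖fderiv ℝ f x x‖ ^ 2 ≤ ‖x‖ ^ 2 * gradNormSq f x := by
  rw [fderiv_self_eq_sum, ← sum_coord_sq]
  calc _ ≤ (∑ j : Fin n, |x j| * ‖∂_{e j} f x‖) ^ 2 := by
        gcongr
        refine (norm_sum_le _ _).trans_eq ?_
        simp only [norm_smul, Real.norm_eq_abs]
    _ ≤ (∑ j, |x j| ^ 2) * ∑ j : Fin n, ‖∂_{e j} f x‖ ^ 2 := Finset.sum_mul_sq_le_sq_mul_sq _ _ _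
    _ = _ := by
        simp only [sq_abs]
        rfl

lemma angDensity_nonneg {δ : ℝ} (hδ : 0 ≤ δ) (f : 𝓢(EuclideanSpace ℝ (Fin n), ℂ))
    (x : EuclideanSpace ℝ (Fin n)) : 0 ≤ angDensity δ f x := by
  have hG : 0 ≤ gradNormSq f x := Finset.sum_nonneg fun j _ => sq_nonneg _
  rcases (add_nonneg hδ (sq_nonneg ‖x‖)).eq_or_lt with h0 | h0
  · simp [angDensity, wt, ← h0, Real.zero_rpow]
  have h : wt δ (-1 / 2) x = (δ + ‖x‖ ^ 2) * wt δ (-3 / 2) x := by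
    rw [wt, wt, show (-3 / 2 : ℝ) = -1 / 2 - 1 by norm_num, Real.rpow_sub_one h0.ne']
    field_simp
  have h3 : 0 ≤ wt δ (-3 / 2) x := Real.rpow_nonneg h0.le _
  rw [angDensity, h, mul_comm (δ + _), mul_assoc, ← mul_sub]
  refine mul_nonneg h3 ?_
  nlinarith [norm_fderiv_self_sq_le f x, mul_nonneg hδ hG]

lemma angDensity_zero (u : EuclideanSpace ℝ (Fin n) → ℂ) (x : EuclideanSpace ℝ (Fin n)) :
    (gradNormSq u x - ‖radialDeriv u x‖ ^ 2) / ‖x‖ = angDensity 0 u x := by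
  rcases eq_or_ne x 0 with rfl | hx
  · simp [angDensity, wt, Real.zero_rpow]
  have hx' : 0 < ‖x‖ := norm_pos_iff.2 hx
  have h1 : wt 0 (-1 / 2) x = ‖x‖⁻¹ := by
    rw [wt, zero_add, ← Real.rpow_natCast, ← Real.rpow_mul hx'.le, ← Real.rpow_neg_one]
    norm_num
  have h3 : wt 0 (-3 / 2) x = (‖x‖ ^ 3)⁻¹ := by
    rw [wt, zero_add, ← Real.rpow_natCast, ← Real.rpow_mul hx'.le, ← Real.rpow_natCast,
      ← Real.rpow_neg hx'.le]
    norm_num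
  rw [angDensity, h1, h3, radialDeriv, map_smul, norm_smul, norm_inv, norm_norm]
  field_simp

lemma tendsto_angDensity (u : EuclideanSpace ℝ (Fin n) → ℂ) {x : EuclideanSpace ℝ (Fin n)}
    (hx : x ≠ 0) :
    Tendsto (fun k : ℕ => angDensity (1 / (k + 1 : ℝ)) u x) atTop (𝓝 (angDensity 0 u x)) := by
  have hw : ∀ p : ℝ, Tendsto (fun k : ℕ => wt (1 / (k + 1 : ℝ)) p x) atTop (𝓝 (wt 0 p x)) := by
    intro p
    refine ((tendsto_one_div_add_atTop_nhds_zero_nat (𝕜 := ℝ)).add_const _).rpow_const (Or.inl ?_)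
    simpa using hx
  exact ((hw _).mul_const _).sub ((hw _).mul_const _)

/-- Fatou's lemma for Bochner integrals of nonnegative functions. -/
lemma ofReal_integral_le_liminf {α : Type*} [MeasurableSpace α] {μ : Measure α} {F : α → ℝ}
    {G : ℕ → α → ℝ} (hF : ∀ x, 0 ≤ F x) (hG : ∀ k, 0 ≤ᵐ[μ] G k) (hGi : ∀ k, Integrable (G k) μ)
    (hFG : ∀ x, ENNReal.ofReal (F x) ≤ liminf (fun k => ENNReal.ofReal (G k x)) atTop) :
    ENNReal.ofReal (∫ x, F x ∂μ) ≤ liminf (fun k => ENNReal.ofReal (∫ x, G k x ∂μ)) atTop := by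
  by_cases hFi : Integrable F μ
  · rw [ofReal_integral_eq_lintegral_ofReal hFi (.of_forall hF)]
    simp only [fun k => ofReal_integral_eq_lintegral_ofReal (hGi k) (hG k)]
    exact (lintegral_mono hFG).trans
      (lintegral_liminf_le' fun k => (hGi k).aestronglyMeasurable.aemeasurable.ennreal_ofReal)
  · simp [integral_undef hFi]

lemma ofReal_integral_angDensity_le (hn : 4 ≤ n) (f : 𝓢(EuclideanSpace ℝ (Fin n), ℂ)) :
    ENNReal.ofReal (∫ x, angDensity 0 f x) ≤ liminf (fun k : ℕ => ENNReal.ofReal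
      (-⟪toL2 n (morawetzOp n (1 / (k + 1 : ℝ)) f), toL2 n (Δ f)⟫)) atTop := by
  have hδ : ∀ k : ℕ, (0 : ℝ) < 1 / (k + 1 : ℝ) := fun k => by positivity
  refine (ofReal_integral_le_liminf (G := fun k : ℕ => angDensity (1 / (k + 1 : ℝ)) f)
    (angDensity_nonneg le_rfl f) (fun k => .of_forall (angDensity_nonneg (hδ k).le f))
    (fun k => (integral_angDensity (hδ k) f).1) fun x => ?_).trans ?_
  · rcases eq_or_ne x 0 with rfl | hx
    · simp [angDensity, wt, Real.zero_rpow]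
    · exact (ENNReal.tendsto_ofReal (tendsto_angDensity f hx)).liminf_eq.ge
  · exact liminf_le_liminf (.of_forall fun k =>
      ENNReal.ofReal_le_ofReal (integral_angDensity_le hn (hδ k) f))

lemma commutator_nonneg (hn : 4 ≤ n) {δ : ℝ} (hδ : 0 < δ)
    (f : 𝓢(EuclideanSpace ℝ (Fin n), ℂ)) :
    0 ≤ -⟪toL2 n (morawetzOp n δ f), toL2 n (Δ f)⟫ :=
  (integral_nonneg (angDensity_nonneg hδ.le f)).trans (integral_angDensity_le hn hδ f)

/-- The space-time bound for the regularised commutator. -/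
lemma integral_commutator_le (hn : 4 ≤ n) {δ : ℝ} (hδ : 0 < δ)
    (f : 𝓢(EuclideanSpace ℝ (Fin n), ℂ)) {T : ℝ} (hT : 0 < T) :
    IntegrableOn (fun t => -⟪toL2 n (morawetzOp n δ (flow t f)), toL2 n (Δ (flow t f))⟫)
      (Set.Ioc 0 T) ∧
    ∫ t in Set.Ioc 0 T, -⟪toL2 n (morawetzOp n δ (flow t f)), toL2 n (Δ (flow t f))⟫ ≤
      (n + n ^ 2) * sobolevNormSq (1 / 2) f := by
  set g := fun t => -⟪toL2 n (morawetzOp n δ (flow t f)), toL2 n (Δ (flow t f))⟫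
  set M := fun t => ⟪toL2 n (flow t f), toL2 n (morawetzSymm n δ (flow t f))⟫
  have hM : ∀ t, HasDerivAt M (2 * g t) t := hasDerivAt_morawetz hn hδ f
  have hint : IntegrableOn (fun t => 2 * g t) (Set.Ioc 0 T) :=
    intervalIntegral.integrableOn_deriv_of_nonneg
      (fun t _ => (hM t).continuousAt.continuousWithinAt) (fun t _ => hM t)
      fun t _ => mul_nonneg zero_le_two (commutator_nonneg hn hδ _)
  have hFTC : ∫ t in Set.Ioc 0 T, 2 * g t = M T - M 0 := by
    rw [← intervalIntegral.integral_of_le hT.le]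
    exact intervalIntegral.integral_eq_sub_of_hasDerivAt (fun t _ => hM t)
      ((intervalIntegrable_iff_integrableOn_Ioc_of_le hT.le).2 hint)
  have hb : ∀ t, |M t| ≤ (n + n ^ 2) * sobolevNormSq (1 / 2) f := fun t => by
    rw [sobolevNormSq_eq, ← norm_bessel_flow _ t]
    exact abs_inner_morawetzSymm_le hn hδ _
  refine ⟨by simpa [IntegrableOn, Function.comp_def] using! hint.const_mul (1 / 2), ?_⟩
  rw [integral_const_mul] at hFTC
  linarith [le_abs_self (M T), neg_abs_le (M 0), hb T, hb 0]

end Morawetz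

/-- **Angular Morawetz estimate** for the free Schrödinger equation in dimension `n ≥ 4`:
there is `C = C(n)` such that for all Schwartz data `ψ₀` and all `T > 0`,
`∫₀^T ∫ (|∇ψ|² − |∂_r ψ|²)/|x| dx dt ≤ C ‖ψ₀‖²_{H^{1/2}}`. -/
theorem morawetz_angular_estimate (n : ℕ) (hn : 4 ≤ n) :
    ∃ C : ℝ, ∀ (ψ₀ : SchwartzMap (EuclideanSpace ℝ (Fin n)) ℂ) (T : ℝ), 0 < T →
      (∫ t in Set.Ioc (0 : ℝ) T,
          ∫ x, (gradNormSq (schrodSol ψ₀ t) x - ‖radialDeriv (schrodSol ψ₀ t) x‖ ^ 2) / ‖x‖)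
        ≤ C * sobolevNormSq ((1 : ℝ) / 2) (⇑ψ₀) := by
  refine ⟨n + n ^ 2, fun ψ₀ T hT => ?_⟩
  have hS : 0 ≤ (n + n ^ 2) * sobolevNormSq ((1 : ℝ) / 2) ψ₀ := by
    rw [Morawetz.sobolevNormSq_eq]
    positivity
  simp only [Morawetz.schrodSol_eq, Morawetz.angDensity_zero]
  rw [← ENNReal.ofReal_le_ofReal_iff hS]
  have hδ : ∀ k : ℕ, (0 : ℝ) < 1 / (k + 1 : ℝ) := fun k => by positivity
  refine (Morawetz.ofReal_integral_le_liminf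
    (fun t => integral_nonneg (Morawetz.angDensity_nonneg le_rfl (Morawetz.flow t ψ₀)))
    (fun k => .of_forall fun t => Morawetz.commutator_nonneg hn (hδ k) (Morawetz.flow t ψ₀))
    (fun k => (Morawetz.integral_commutator_le hn (hδ k) ψ₀ hT).1)
    fun t => Morawetz.ofReal_integral_angDensity_le hn (Morawetz.flow t ψ₀)).trans ?_
  exact (Filter.liminf_le_liminf (.of_forall fun k => ENNReal.ofReal_le_ofReal
    (Morawetz.integral_commutator_le hn (hδ k) ψ₀ hT).2)).trans_eq
    (Filter.liminf_const _)
end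

section
/- Let n ≥ 4 (local smoothing estimate). For every R > 0 and T > 0 there is a constant C (depending only on n, R, T) such that for every ψ₀ ∈ 𝒮(ℝⁿ) and ψ the solution of the free Schrödinger equation with initial data ψ₀, ∫_0^T ∫_{|x| ≤ R} |∇_x ψ(t,x)|² dx dt ≤ C ‖ψ₀‖²_{H^{1/2}}; that is, on average in time the solution is locally half a derivative smoother than the initial data. -/
open MeasureTheory
open scoped RealInnerProductSpace

theorem lintegral_gaussian_shift {b : ℝ} (hb : 0 < b) (r : ℝ) :
    ∫⁻ s : ℝ, ENNReal.ofReal (Real.exp (-b * (s - r) ^ 2)) = ENNReal.ofReal (√(Real.pi / b)) := by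
  rw [lintegral_sub_right_eq_self (fun s : ℝ => ENNReal.ofReal (Real.exp (-b * s ^ 2))) r,
    ← ofReal_integral_eq_lintegral_ofReal (integrable_exp_neg_mul_sq hb)
      (Filter.Eventually.of_forall fun _ => (Real.exp_pos _).le), integral_gaussian]

/-- Near `s = α` the factor `s + r` is bounded below by `|α| / 2`; away from it the first Gaussian
is already small. -/
theorem exp_kernel_le (α c s : ℝ) (r : ℝ) (hr : r = if 0 ≤ α then √c else -√c) :
    Real.exp (-(α - s) ^ 2 / 4) * Real.exp (-(s ^ 2 - c) ^ 2 / 4) ≤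
      Real.exp (-(α ^ 2 / 16) * (s - r) ^ 2) +
        Real.exp (-α ^ 2 / 32) * Real.exp (-(1 / 8) * (s - α) ^ 2) := by
  rw [← Real.exp_add, ← Real.exp_add]
  by_cases h : α ^ 2 ≤ 4 * (s - α) ^ 2
  · refine le_add_of_nonneg_of_le (Real.exp_pos _).le (Real.exp_le_exp.2 ?_)
    nlinarith [sq_nonneg (s ^ 2 - c)]
  · refine le_add_of_le_of_nonneg (Real.exp_le_exp.2 ?_) (Real.exp_pos _).le
    have key : (α ^ 2 / 4) * (s - r) ^ 2 ≤ (s ^ 2 - c) ^ 2 := by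
      have hsr : 0 ≤ s * r ∧ α ^ 2 / 4 ≤ s ^ 2 := by
        have h0 := Real.sqrt_nonneg c
        push Not at h
        constructor
        · have : 0 ≤ s * α := by nlinarith
          split_ifs at hr with ha
          · rcases ha.eq_or_lt with rfl | ha
            · nlinarith [sq_nonneg s]
            · rw [hr]; exact mul_nonneg (nonneg_of_mul_nonneg_left this ha) h0
          · rw [hr]; exact mul_nonneg_of_nonpos_of_nonpos (by nlinarith) (by linarith)
        · have := abs_lt_of_sq_lt_sq (a := 2 * (s - α)) (b := |α|) (by rw [sq_abs]; linarith)
            (abs_nonneg _)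
          rw [abs_lt] at this
          have : |α| / 2 ≤ |s| := by
            rcases abs_cases α with h | h <;> rcases abs_cases s with h' | h' <;> linarith
          have := pow_le_pow_left₀ (by positivity) this 2
          rw [div_pow, sq_abs, sq_abs] at this
          linarith
      obtain ⟨h1, h2⟩ := hsr
      by_cases hc : 0 ≤ c
      · have hrc : r ^ 2 = c := by
          rw [hr]; split_ifs <;> simp [Real.sq_sqrt hc]
        have : (s ^ 2 - c) ^ 2 = (s - r) ^ 2 * (s + r) ^ 2 := by rw [← hrc]; ring
        rw [this, mul_comm]
        gcongr
        nlinarith [sq_nonneg r]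
      · have hrc : r = 0 := by
          rw [hr, Real.sqrt_eq_zero_of_nonpos (by linarith)]; simp
        rw [hrc, sub_zero]
        calc α ^ 2 / 4 * s ^ 2 ≤ s ^ 2 * s ^ 2 := by gcongr
          _ = (s ^ 2) ^ 2 := by ring
          _ ≤ (s ^ 2 - c) ^ 2 := by gcongr; linarith
    nlinarith [sq_nonneg (α - s)]

theorem lintegral_kernel_one_dim_le {α : ℝ} (hα : α ≠ 0) (c : ℝ) :
    ∫⁻ s : ℝ, ENNReal.ofReal (Real.exp (-(α - s) ^ 2 / 4) * Real.exp (-(s ^ 2 - c) ^ 2 / 4)) ≤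
      ENNReal.ofReal (110 / |α|) := by
  set r := if 0 ≤ α then √c else -√c with hr
  have hα' : 0 < |α| := abs_pos.2 hα
  calc _ ≤ ∫⁻ s : ℝ, (ENNReal.ofReal (Real.exp (-(α ^ 2 / 16) * (s - r) ^ 2)) +
        ENNReal.ofReal (Real.exp (-α ^ 2 / 32)) *
          ENNReal.ofReal (Real.exp (-(1 / 8) * (s - α) ^ 2))) := by
        refine lintegral_mono fun s => ?_
        rw [← ENNReal.ofReal_mul (Real.exp_pos _).le, ← ENNReal.ofReal_add (by positivity)
          (by positivity)]
        exact ENNReal.ofReal_le_ofReal (exp_kernel_le α c s r hr)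
    _ = ENNReal.ofReal (√(Real.pi / (α ^ 2 / 16)) +
          Real.exp (-α ^ 2 / 32) * √(Real.pi / (1 / 8))) := by
        rw [lintegral_add_left (by fun_prop), lintegral_const_mul _ (by fun_prop),
          lintegral_gaussian_shift (by positivity), lintegral_gaussian_shift (by norm_num),
          ENNReal.ofReal_add (by positivity) (by positivity),
          ENNReal.ofReal_mul (Real.exp_pos _).le]
    _ ≤ _ := by
        refine ENNReal.ofReal_le_ofReal ?_
        have h1 : √(Real.pi / (α ^ 2 / 16)) ≤ 10 / |α| := by
          refine Real.sqrt_le_iff.2 ⟨by positivity, ?_⟩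
          rw [div_pow, sq_abs, div_div_eq_mul_div]
          gcongr
          nlinarith [Real.pi_lt_four]
        have h2 : √(Real.pi / (1 / 8)) ≤ 6 := by
          refine Real.sqrt_le_iff.2 ⟨by norm_num, ?_⟩
          linarith [Real.pi_lt_four]
        have h3 : Real.exp (-α ^ 2 / 32) ≤ 16 / |α| := by
          rw [neg_div, Real.exp_neg, inv_le_comm₀ (Real.exp_pos _) (by positivity), inv_div]
          have := Real.add_one_le_exp (α ^ 2 / 32)
          rw [← sq_abs] at this ⊢
          nlinarith [sq_nonneg (|α| - 1)]
        calc _ ≤ 10 / |α| + 16 / |α| * 6 := by gcongr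
          _ ≤ 110 / |α| := by rw [div_mul_eq_mul_div, ← add_div]; gcongr; norm_num

theorem exists_lintegral_kernel_le (n : ℕ) : ∃ A : NNReal, ∀ (j : Fin n)
    (ξ : EuclideanSpace ℝ (Fin n)), ξ j ≠ 0 →
    ∫⁻ η : EuclideanSpace ℝ (Fin n), ENNReal.ofReal (Real.exp (-‖ξ - η‖ ^ 2 / 4) *
      Real.exp (-(‖ξ‖ ^ 2 - ‖η‖ ^ 2) ^ 2 / 4)) ≤ A * ENNReal.ofReal (1 / |ξ j|) := by
  rcases n with _ | m
  · exact ⟨0, fun j => j.elim0⟩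
  have hfin : ∫⁻ y : Fin m → ℝ, ENNReal.ofReal (Real.exp (-(∑ i, y i ^ 2) / 4)) < ⊤ := by
    have : Integrable (fun y : Fin m → ℝ => ∏ i, Real.exp (-(1 / 4) * y i ^ 2)) :=
      Integrable.fintype_prod fun i => integrable_exp_neg_mul_sq (by norm_num)
    refine lt_of_eq_of_lt ?_ this.lintegral_lt_top
    congr! 3 with y
    rw [← Real.exp_sum, ← Finset.mul_sum]
    ring_nf
  refine ⟨110 * (∫⁻ y : Fin m → ℝ,
    ENNReal.ofReal (Real.exp (-(∑ i, y i ^ 2) / 4))).toNNReal, fun j ξ hξ => ?_⟩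
  have hmeas : Measurable fun η : EuclideanSpace ℝ (Fin (m + 1)) =>
      ENNReal.ofReal (Real.exp (-‖ξ - η‖ ^ 2 / 4) *
      Real.exp (-(‖ξ‖ ^ 2 - ‖η‖ ^ 2) ^ 2 / 4)) := by fun_prop
  have hmp := (PiLp.volume_preserving_toLp (Fin (m + 1))).comp
    (volume_preserving_piFinSuccAbove (fun _ => ℝ) j).symm
  rw [← hmp.lintegral_comp hmeas, Measure.volume_eq_prod]
  refine (lintegral_prod_symm _ (hmeas.comp hmp.measurable).aemeasurable).trans_le ?_
  set ξ' : Fin m → ℝ := fun i => ξ (j.succAbove i)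
  have hpt : ∀ (y : Fin m → ℝ) (s : ℝ), ENNReal.ofReal (Real.exp (-‖ξ -
      (WithLp.toLp 2 ∘ (MeasurableEquiv.piFinSuccAbove (fun _ => ℝ) j).symm) (s, y)‖ ^ 2 / 4) *
      Real.exp (-(‖ξ‖ ^ 2 -
        ‖(WithLp.toLp 2 ∘ (MeasurableEquiv.piFinSuccAbove (fun _ => ℝ) j).symm) (s, y)‖ ^ 2) ^ 2
          / 4)) =
      ENNReal.ofReal (Real.exp (-(∑ i, ((ξ' - y) i) ^ 2) / 4)) *
      ENNReal.ofReal (Real.exp (-(ξ j - s) ^ 2 / 4) *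
        Real.exp (-(s ^ 2 - (‖ξ‖ ^ 2 - ∑ i, y i ^ 2)) ^ 2 / 4)) := by
    intro y s
    have hz : (WithLp.toLp 2 ∘ (MeasurableEquiv.piFinSuccAbove (fun _ => ℝ) j).symm) (s, y) =
      WithLp.toLp 2 (j.insertNth (α := fun _ => ℝ) s y) := rfl
    rw [hz, ← ENNReal.ofReal_mul (Real.exp_pos _).le]
    have h1 : ‖ξ - WithLp.toLp 2 (j.insertNth (α := fun _ => ℝ) s y)‖ ^ 2 =
        (ξ j - s) ^ 2 + ∑ i, ((ξ' - y) i) ^ 2 := by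
      simp [EuclideanSpace.real_norm_sq_eq, Fin.sum_univ_succAbove _ j, ξ']
    have h2 : ‖WithLp.toLp 2 (j.insertNth (α := fun _ => ℝ) s y)‖ ^ 2 = s ^ 2 + ∑ i, y i ^ 2 := by
      simp [EuclideanSpace.real_norm_sq_eq, Fin.sum_univ_succAbove _ j]
    rw [h1, h2]
    simp only [← Real.exp_add]
    ring_nf
  refine (lintegral_mono fun y => (lintegral_congr (hpt y)).le).trans ?_
  calc _ ≤ ∫⁻ y : Fin m → ℝ, ENNReal.ofReal (Real.exp (-(∑ i, ((ξ' - y) i) ^ 2) / 4)) *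
        ENNReal.ofReal (110 / |ξ j|) := by
        refine lintegral_mono fun y => ?_
        rw [lintegral_const_mul _ (by fun_prop)]
        gcongr
        exact lintegral_kernel_one_dim_le hξ _
    _ = _ := by
        rw [lintegral_mul_const _ (by fun_prop),
          lintegral_sub_left_eq_self (fun y : Fin m → ℝ =>
            ENNReal.ofReal (Real.exp (-(∑ i, (y i) ^ 2) / 4))) ξ']
        rw [div_eq_mul_one_div, ENNReal.ofReal_mul (by norm_num)]
        push_cast
        rw [ENNReal.coe_toNNReal hfin.ne]
        simp
        ring

/-- Expanding the square of an oscillatory integral and integrating the weight first. -/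
theorem lintegral_mul_enorm_sq_oscillatory_le {V Ξ : Type*} [MeasurableSpace V] [MeasurableSpace Ξ]
    {μ : Measure V} {ν : Measure Ξ} [SFinite μ] [SFinite ν] {w : V → ℝ} (hw : Integrable w μ)
    (hw0 : ∀ v, 0 ≤ w v) {h : Ξ → ℂ} (hh : Integrable h ν) {φ : V → Ξ → ℝ}
    (hφ : Measurable (Function.uncurry φ)) :
    ∫⁻ v, ENNReal.ofReal (w v) * ‖∫ ξ, Complex.exp (Complex.I * φ v ξ) * h ξ ∂ν‖ₑ ^ 2 ∂μ ≤
      ∫⁻ p : Ξ × Ξ, ‖h p.1‖ₑ * ‖h p.2‖ₑ *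
        ‖∫ v, w v * Complex.exp (Complex.I * (φ v p.1 - φ v p.2)) ∂μ‖ₑ ∂(ν.prod ν) := by
  set D : V → ℂ := fun v => ∫ ξ, Complex.exp (Complex.I * φ v ξ) * h ξ ∂ν with hD
  have hDnorm : ∀ v, ‖D v‖ ≤ ∫ ξ, ‖h ξ‖ ∂ν := fun v => by
    refine (norm_integral_le_integral_norm _).trans_eq ?_
    simp [mul_comm Complex.I, Complex.norm_exp_ofReal_mul_I]
  have hmexp : Measurable fun p : V × Ξ => Complex.exp (Complex.I * φ p.1 p.2) := by
    have : Measurable fun p : V × Ξ => φ p.1 p.2 := hφ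
    fun_prop
  have hDmeas : AEStronglyMeasurable D μ := by
    refine AEStronglyMeasurable.integral_prod_right' (f := fun p : V × Ξ =>
      Complex.exp (Complex.I * φ p.1 p.2) * h p.2) ?_
    exact hmexp.aestronglyMeasurable.mul hh.aestronglyMeasurable.comp_snd
  have hint : Integrable (fun v => w v * ‖D v‖ ^ 2) μ := by
    refine hw.mul_bdd (c := (∫ ξ, ‖h ξ‖ ∂ν) ^ 2) (hDmeas.norm.pow 2) (.of_forall fun v => ?_)
    rw [norm_pow, norm_norm]
    gcongr
    exact hDnorm v
  have hlhs : ∫⁻ v, ENNReal.ofReal (w v) * ‖D v‖ₑ ^ 2 ∂μ =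
      ‖∫ v, (w v : ℂ) * (D v * (starRingEnd ℂ) (D v)) ∂μ‖ₑ := by
    have : ∀ v, (w v : ℂ) * (D v * (starRingEnd ℂ) (D v)) = ((w v * ‖D v‖ ^ 2 : ℝ) : ℂ) :=
      fun v => by rw [Complex.mul_conj']; push_cast; ring
    simp_rw [this]
    rw [integral_complex_ofReal, ← ofReal_norm, Complex.norm_real, Real.norm_of_nonneg
      (integral_nonneg fun v => mul_nonneg (hw0 v) (sq_nonneg _)),
      ofReal_integral_eq_lintegral_ofReal hint
        (.of_forall fun v => mul_nonneg (hw0 v) (sq_nonneg _))]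
    congr! 2 with v
    rw [ENNReal.ofReal_mul (hw0 v), ENNReal.ofReal_pow (norm_nonneg _), ofReal_norm]
  set g : V → Ξ × Ξ → ℂ := fun v p => (w v : ℂ) *
    ((Complex.exp (Complex.I * φ v p.1) * h p.1) *
      (starRingEnd ℂ) (Complex.exp (Complex.I * φ v p.2) * h p.2)) with hg
  have hgint : Integrable (Function.uncurry g) (μ.prod (ν.prod ν)) := by
    have h1 : Integrable (fun q : V × Ξ × Ξ => (w q.1 : ℂ) *
        (h q.2.1 * (starRingEnd ℂ) (h q.2.2))) (μ.prod (ν.prod ν)) :=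
      hw.ofReal.mul_prod (hh.mul_prod
        ((Complex.conjLIE.toContinuousLinearEquiv : ℂ →L[ℝ] ℂ).integrable_comp hh))
    have h2 : AEStronglyMeasurable (fun q : V × Ξ × Ξ => Complex.exp (Complex.I * φ q.1 q.2.1) *
        (starRingEnd ℂ) (Complex.exp (Complex.I * φ q.1 q.2.2))) (μ.prod (ν.prod ν)) := by
      refine Measurable.aestronglyMeasurable ?_
      refine (hmexp.comp (measurable_fst.prodMk measurable_snd.fst)).mul ?_
      exact Complex.continuous_conj.measurable.comp
        (hmexp.comp (measurable_fst.prodMk measurable_snd.snd))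
    refine (h1.bdd_mul (c := 1) h2 (.of_forall fun q => ?_)).congr (.of_forall fun q => ?_)
    · simp [mul_comm Complex.I, Complex.norm_exp_ofReal_mul_I]
    · simp only [hg, Function.uncurry, map_mul]; ring
  have hfub : ∫ v, (w v : ℂ) * (D v * (starRingEnd ℂ) (D v)) ∂μ =
      ∫ p, ∫ v, g v p ∂μ ∂(ν.prod ν) := by
    rw [← integral_integral_swap hgint]
    congr! 2 with v
    rw [hg, integral_const_mul, integral_prod_mul
      (fun ξ => Complex.exp (Complex.I * φ v ξ) * h ξ)
      (fun ξ => (starRingEnd ℂ) (Complex.exp (Complex.I * φ v ξ) * h ξ)), integral_conj]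
  rw [hlhs, hfub]
  refine (enorm_integral_le_lintegral_enorm _).trans (lintegral_mono fun p => ?_)
  have : ∀ v, g v p = (h p.1 * (starRingEnd ℂ) (h p.2)) *
      (w v * Complex.exp (Complex.I * (φ v p.1 - φ v p.2))) := fun v => by
    rw [mul_sub, sub_eq_add_neg, Complex.exp_add]
    simp only [hg, map_mul, ← Complex.exp_conj, Complex.conj_I, Complex.conj_ofReal]
    ring_nf
  simp_rw [this]
  rw [integral_const_mul, enorm_mul, enorm_mul]
  simp

/-- Schur test for a symmetric kernel. -/
theorem lintegral_schur_le {Ξ : Type*} [MeasurableSpace Ξ] {ν : Measure Ξ} [SFinite ν]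
    {f : Ξ → ENNReal} (hf : Measurable f) {K : Ξ → Ξ → ENNReal}
    (hK : Measurable (Function.uncurry K)) (hsymm : ∀ ξ η, K ξ η = K η ξ) :
    ∫⁻ p : Ξ × Ξ, f p.1 * f p.2 * K p.1 p.2 ∂(ν.prod ν) ≤
      ∫⁻ ξ, f ξ ^ 2 * ∫⁻ η, K ξ η ∂ν ∂ν := by
  have hK' : Measurable fun p : Ξ × Ξ => K p.1 p.2 := hK
  have hamgm : ∀ a b : ENNReal, a * b ≤ 2⁻¹ * a ^ 2 + 2⁻¹ * b ^ 2 := fun a b => by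
    simpa [ENNReal.div_eq_inv_mul] using ENNReal.young_inequality a b .two_two
  have h1 : ∫⁻ p : Ξ × Ξ, f p.1 ^ 2 * K p.1 p.2 ∂(ν.prod ν) =
      ∫⁻ ξ, f ξ ^ 2 * ∫⁻ η, K ξ η ∂ν ∂ν := by
    rw [lintegral_prod _ (by fun_prop)]
    refine lintegral_congr fun ξ => ?_
    exact lintegral_const_mul (f ξ ^ 2) (f := fun η => K ξ η) (hK.comp measurable_prodMk_left)
  have h2 : ∫⁻ p : Ξ × Ξ, f p.2 ^ 2 * K p.1 p.2 ∂(ν.prod ν) =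
      ∫⁻ ξ, f ξ ^ 2 * ∫⁻ η, K ξ η ∂ν ∂ν := by
    rw [← h1, ← lintegral_prod_swap]
    simp [hsymm]
  calc _ ≤ ∫⁻ p : Ξ × Ξ, (2⁻¹ * (f p.1 ^ 2 * K p.1 p.2) + 2⁻¹ * (f p.2 ^ 2 * K p.1 p.2))
        ∂(ν.prod ν) := by
        refine lintegral_mono fun p => ?_
        rw [← mul_assoc, ← mul_assoc, ← add_mul]
        gcongr
        exact hamgm _ _
    _ = _ := by
        rw [lintegral_add_left (by fun_prop), lintegral_const_mul _ (by fun_prop),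
          lintegral_const_mul _ (by fun_prop), h1, h2, ← add_mul, ENNReal.inv_two_add_inv_two,
          one_mul]

theorem integral_gaussian_phase {V : Type*} [NormedAddCommGroup V] [InnerProductSpace ℝ V]
    [FiniteDimensional ℝ V] [MeasurableSpace V] [BorelSpace V] (w : V) :
    ‖∫ v : V, (Real.exp (-‖v‖ ^ 2) : ℂ) * Complex.exp (Complex.I * ⟪w, v⟫)‖ =
      Real.pi ^ (Module.finrank ℝ V / 2 : ℝ) * Real.exp (-‖w‖ ^ 2 / 4) := by
  have := GaussianFourier.integral_cexp_neg_mul_sq_norm_add (V := V) (b := 1) (by simp)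
    Complex.I w
  simp only [neg_mul, one_mul, div_one, mul_one, Complex.I_sq] at this
  simp_rw [Complex.ofReal_exp, ← Complex.exp_add]
  push_cast
  rw [this, norm_mul, Complex.norm_exp]
  congr 1
  · rw [← Complex.ofReal_ofNat, ← Complex.ofReal_natCast, ← Complex.ofReal_div,
      ← Complex.ofReal_cpow Real.pi_pos.le, Complex.norm_real, Real.norm_of_nonneg (by positivity)]
  · congr 1
    norm_cast

/-- The phase of the free Schrödinger evolution at the space-time point `v`. -/
noncomputable def schrodPhase {n : ℕ} (v : ℝ × EuclideanSpace ℝ (Fin n))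
    (ξ : EuclideanSpace ℝ (Fin n)) : ℝ :=
  ⟪v.2, ξ⟫ - v.1 * ‖ξ‖ ^ 2

theorem continuous_schrodPhase {n : ℕ} :
    Continuous (Function.uncurry (schrodPhase (n := n))) := by
  unfold schrodPhase Function.uncurry
  fun_prop

/-- A Gaussian weight in space-time. -/
noncomputable def gaussianWeight {n : ℕ} (v : ℝ × EuclideanSpace ℝ (Fin n)) : ℝ :=
  Real.exp (-‖v.1‖ ^ 2) * Real.exp (-‖v.2‖ ^ 2)

theorem integrable_exp_neg_norm_sq (V : Type*) [NormedAddCommGroup V] [InnerProductSpace ℝ V]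
    [FiniteDimensional ℝ V] [MeasurableSpace V] [BorelSpace V] :
    Integrable (fun v : V => Real.exp (-‖v‖ ^ 2)) := by
  have := (GaussianFourier.integrable_cexp_neg_mul_sq_norm_add (V := V) (b := 1) (by simp)
    0 0).norm
  refine this.congr (.of_forall fun v => ?_)
  simp only [Complex.norm_exp]
  congr 1
  simp
  norm_cast

theorem integrable_gaussianWeight {n : ℕ} : Integrable (gaussianWeight (n := n)) :=
  (integrable_exp_neg_norm_sq ℝ).mul_prod (integrable_exp_neg_norm_sq _)

theorem norm_integral_gaussianWeight {n : ℕ} (ξ η : EuclideanSpace ℝ (Fin n)) :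
    ‖∫ v, (gaussianWeight v : ℂ) *
      Complex.exp (Complex.I * (schrodPhase v ξ - schrodPhase v η))‖ =
    Real.pi ^ ((n + 1) / 2 : ℝ) * (Real.exp (-‖ξ - η‖ ^ 2 / 4) *
      Real.exp (-(‖ξ‖ ^ 2 - ‖η‖ ^ 2) ^ 2 / 4)) := by
  have h : ∀ v : ℝ × EuclideanSpace ℝ (Fin n), (gaussianWeight v : ℂ) *
      Complex.exp (Complex.I * (schrodPhase v ξ - schrodPhase v η)) =
      ((Real.exp (-‖v.1‖ ^ 2) : ℂ) *
        Complex.exp (Complex.I * ⟪‖η‖ ^ 2 - ‖ξ‖ ^ 2, v.1⟫)) *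
      ((Real.exp (-‖v.2‖ ^ 2) : ℂ) * Complex.exp (Complex.I * ⟪ξ - η, v.2⟫)) := fun v => by
    rw [mul_mul_mul_comm, ← Complex.exp_add, gaussianWeight, schrodPhase, schrodPhase,
      inner_sub_left ξ, real_inner_comm v.2, real_inner_comm v.2]
    simp only [RCLike.inner_apply, conj_trivial]
    push_cast
    congr 2
    ring
  simp_rw [h]
  rw [Measure.volume_eq_prod, integral_prod_mul (fun t : ℝ => (Real.exp (-‖t‖ ^ 2) : ℂ) *
        Complex.exp (Complex.I * ⟪‖η‖ ^ 2 - ‖ξ‖ ^ 2, t⟫)) (fun x : EuclideanSpace ℝ (Fin n) =>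
        (Real.exp (-‖x‖ ^ 2) : ℂ) * Complex.exp (Complex.I * ⟪ξ - η, x⟫)), norm_mul,
    integral_gaussian_phase, integral_gaussian_phase]
  simp only [Module.finrank_self, finrank_euclideanSpace, Fintype.card_fin, Real.norm_eq_abs,
    sq_abs]
  rw [add_div, Real.rpow_add Real.pi_pos, ← neg_sub (‖ξ‖ ^ 2), neg_sq]
  push_cast
  ring

theorem exists_schwartzMap_eq_fourierT {n : ℕ} (u : SchwartzMap (EuclideanSpace ℝ (Fin n)) ℂ) :
    ∃ S : SchwartzMap (EuclideanSpace ℝ (Fin n)) ℂ, fourierT u = S := by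
  let e : EuclideanSpace ℝ (Fin n) ≃L[ℝ] EuclideanSpace ℝ (Fin n) :=
    ContinuousLinearEquiv.smulLeft (Units.mk0 ((2 * Real.pi)⁻¹) (by positivity))
  refine ⟨(((2 * Real.pi) ^ (-(n : ℝ) / 2) : ℝ) : ℂ) •
    SchwartzMap.compCLMOfContinuousLinearEquiv ℂ e (FourierTransform.fourier u), ?_⟩
  funext ξ
  simp only [fourierT, smul_apply, SchwartzMap.compCLMOfContinuousLinearEquiv_apply,
    Function.comp_apply, smul_eq_mul, SchwartzMap.fourier_coe, Real.fourier_eq']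
  congr! 3 with x
  have : e ξ = (2 * Real.pi)⁻¹ • ξ := rfl
  rw [this, inner_smul_right, ← mul_assoc,
    show -2 * Real.pi * (2 * Real.pi)⁻¹ = -1 by field_simp, neg_mul, neg_mul, one_mul,
    mul_comm Complex.I, Complex.ofReal_neg, neg_mul]

theorem norm_fderiv_schrodSol_le {n : ℕ} (u : SchwartzMap (EuclideanSpace ℝ (Fin n)) ℂ)
    (t : ℝ) (x : EuclideanSpace ℝ (Fin n)) (j : Fin n) :
    ‖fderiv ℝ (schrodSol u t) x (EuclideanSpace.single j 1)‖ ≤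
      (2 * Real.pi) ^ (-(n : ℝ) / 2) *
      ‖∫ ξ, Complex.exp (Complex.I * schrodPhase (t, x) ξ) * (ξ j * fourierT u ξ)‖ := by
  obtain ⟨S, hS⟩ := exists_schwartzMap_eq_fourierT u
  have hrw : schrodSol u t = fun x => (((2 * Real.pi) ^ (-(n : ℝ) / 2) : ℝ) : ℂ) *
      ∫ ξ, Complex.exp (Complex.I * schrodPhase (t, x) ξ) * S ξ := by
    funext x
    rw [schrodSol, hS]
    congr! 3 with ξ
    rw [← Complex.exp_add, schrodPhase]
    push_cast
    ring_nf
  set F' : EuclideanSpace ℝ (Fin n) → EuclideanSpace ℝ (Fin n) →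
      EuclideanSpace ℝ (Fin n) →L[ℝ] ℂ := fun x ξ =>
    (Complex.exp (Complex.I * schrodPhase (t, x) ξ) * Complex.I * S ξ) •
      (Complex.ofRealCLM ∘L innerSL ℝ ξ) with hF'
  have hcont : ∀ x, Continuous fun ξ : EuclideanSpace ℝ (Fin n) =>
      Complex.exp (Complex.I * schrodPhase (t, x) ξ) := fun x => by
    unfold schrodPhase
    fun_prop
  have hnorm : ∀ x ξ, ‖F' x ξ‖ ≤ ‖ξ‖ ^ 1 * ‖S ξ‖ := fun x ξ => by
    rw [hF', norm_smul, pow_one, mul_comm]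
    gcongr
    · refine (ContinuousLinearMap.opNorm_comp_le _ _).trans ?_
      simp
    · simp [mul_comm Complex.I, Complex.norm_exp_ofReal_mul_I]
  have hF'cont : Continuous (F' x) := by
    have := hcont x
    simp only [hF']
    fun_prop
  have hF'int : Integrable (F' x) :=
    (S.integrable_pow_mul volume 1).mono' hF'cont.aestronglyMeasurable (.of_forall (hnorm x))
  have hd : HasFDerivAt (fun x => ∫ ξ, Complex.exp (Complex.I * schrodPhase (t, x) ξ) * S ξ)
      (∫ ξ, F' x ξ) x := by
    refine hasFDerivAt_integral_of_dominated_of_fderiv_le Filter.univ_mem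
      (.of_forall fun y => ((hcont y).mul S.continuous).aestronglyMeasurable) ?_
      hF'cont.aestronglyMeasurable (.of_forall fun ξ y _ => hnorm y ξ)
      (S.integrable_pow_mul volume 1) (.of_forall fun ξ y _ => ?_)
    · refine S.integrable.bdd_mul (c := 1) (hcont x).aestronglyMeasurable (.of_forall fun ξ => ?_)
      simp [mul_comm Complex.I, Complex.norm_exp_ofReal_mul_I]
    · have h1 : HasFDerivAt (fun y => schrodPhase (t, y) ξ) (innerSL ℝ ξ) y := by
        have : (fun y => schrodPhase (t, y) ξ) = fun y => innerSL ℝ ξ y - t * ‖ξ‖ ^ 2 := by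
          funext y; simp [schrodPhase, real_inner_comm]
        rw [this]
        exact (innerSL ℝ ξ).hasFDerivAt.sub_const _
      have h2 := (Complex.ofRealCLM.hasFDerivAt.comp y h1)
      refine ((h2.const_mul Complex.I).cexp.mul_const (S ξ)).congr_fderiv ?_
      ext z
      simp [hF']
      ring
  rw [hrw, (hd.const_mul _).fderiv, smul_apply, norm_smul, Complex.norm_real,
    Real.norm_of_nonneg (by positivity), ContinuousLinearMap.integral_apply hF'int]
  refine le_of_eq (congrArg _ ?_)
  have : ∀ ξ : EuclideanSpace ℝ (Fin n), F' x ξ (EuclideanSpace.single j 1) =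
      Complex.I * (Complex.exp (Complex.I * schrodPhase (t, x) ξ) * (ξ j * fourierT u ξ)) :=
    fun ξ => by
      simp [hF', hS, EuclideanSpace.inner_single_right]
      ring
  simp_rw [this]
  rw [integral_const_mul, norm_mul, Complex.norm_I, one_mul]

theorem integrable_sobolev_integrand {n : ℕ}
    (u : SchwartzMap (EuclideanSpace ℝ (Fin n)) ℂ) :
    Integrable fun ξ => (1 + ‖ξ‖ ^ 2) ^ ((1 : ℝ) / 2) * ‖fourierT u ξ‖ ^ 2 := by
  obtain ⟨S, hS⟩ := exists_schwartzMap_eq_fourierT u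
  rw [hS]
  have hcont : Continuous fun ξ : EuclideanSpace ℝ (Fin n) =>
      (1 + ‖ξ‖ ^ 2) ^ ((1 : ℝ) / 2) * ‖S ξ‖ ^ 2 := by
    refine Continuous.mul ?_ (by fun_prop)
    exact Continuous.rpow_const (by fun_prop) fun _ => .inr (by norm_num)
  obtain ⟨M, hM⟩ := S.decay 0 0
  have hM' : ∀ ξ, ‖S ξ‖ ≤ M := fun ξ => by simpa using hM.2 ξ
  refine (((S.integrable_pow_mul volume 0).add (S.integrable_pow_mul volume 1)).mul_const M).mono'
    hcont.aestronglyMeasurable (.of_forall fun ξ => ?_)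
  rw [Real.norm_of_nonneg (by positivity), ← Real.sqrt_eq_rpow]
  have : √(1 + ‖ξ‖ ^ 2) ≤ 1 + ‖ξ‖ :=
    Real.sqrt_le_iff.2 ⟨by positivity, by nlinarith [norm_nonneg ξ]⟩
  calc _ ≤ (1 + ‖ξ‖) * (‖S ξ‖ * M) := by
        rw [sq ‖S ξ‖]; gcongr; exact hM' ξ
    _ = _ := by simp; ring

theorem exists_lintegral_weight_le (n : ℕ) : ∃ B : NNReal,
    ∀ (u : SchwartzMap (EuclideanSpace ℝ (Fin n)) ℂ) (j : Fin n),
    ∫⁻ v, ENNReal.ofReal (gaussianWeight v) *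
      ‖∫ ξ, Complex.exp (Complex.I * schrodPhase v ξ) * (ξ j * fourierT u ξ)‖ₑ ^ 2 ≤
    B * ENNReal.ofReal (sobolevNormSq (1 / 2) u) := by
  obtain ⟨A, hA⟩ := exists_lintegral_kernel_le n
  refine ⟨(Real.pi ^ ((n + 1) / 2 : ℝ)).toNNReal * A, fun u j => ?_⟩
  have hSob := integrable_sobolev_integrand u
  rw [sobolevNormSq, ofReal_integral_eq_lintegral_ofReal hSob
    (.of_forall fun ξ => by positivity)]
  obtain ⟨S, hS⟩ := exists_schwartzMap_eq_fourierT u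
  rw [hS] at hSob ⊢
  have hcoord : ∀ ξ : EuclideanSpace ℝ (Fin n), |ξ j| ≤ ‖ξ‖ := fun ξ => PiLp.norm_apply_le ξ j
  have hcont : Continuous fun ξ : EuclideanSpace ℝ (Fin n) => (ξ j : ℂ) * S ξ := by fun_prop
  have hint : Integrable fun ξ : EuclideanSpace ℝ (Fin n) => (ξ j : ℂ) * S ξ := by
    refine (S.integrable_pow_mul volume 1).mono' hcont.aestronglyMeasurable (.of_forall fun ξ => ?_)
    rw [norm_mul, Complex.norm_real, pow_one]
    gcongr
    exact hcoord ξ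
  refine (lintegral_mul_enorm_sq_oscillatory_le integrable_gaussianWeight
    (fun v => by unfold gaussianWeight; positivity) hint
    continuous_schrodPhase.measurable).trans ?_
  simp_rw [← ofReal_norm (∫ _, _ : ℂ), norm_integral_gaussianWeight]
  refine (lintegral_schur_le (f := fun ξ : EuclideanSpace ℝ (Fin n) => ‖(ξ j : ℂ) * S ξ‖ₑ)
    (K := fun ξ η => ENNReal.ofReal (Real.pi ^ ((n + 1) / 2 : ℝ) *
      (Real.exp (-‖ξ - η‖ ^ 2 / 4) * Real.exp (-(‖ξ‖ ^ 2 - ‖η‖ ^ 2) ^ 2 / 4))))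
    hcont.measurable.enorm (by unfold Function.uncurry; fun_prop) fun ξ η => ?_).trans ?_
  · rw [norm_sub_rev, ← neg_sub (‖ξ‖ ^ 2), neg_sq]
  rw [← lintegral_const_mul' _ _ ENNReal.coe_ne_top]
  refine lintegral_mono fun ξ => ?_
  by_cases hξ : ξ j = 0
  · simp [hξ]
  simp_rw [ENNReal.ofReal_mul (show 0 ≤ Real.pi ^ ((n + 1) / 2 : ℝ) by positivity)]
  rw [lintegral_const_mul' _ _ ENNReal.ofReal_ne_top]
  calc _ ≤ ENNReal.ofReal (|ξ j| ^ 2 * ‖S ξ‖ ^ 2) *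
        (ENNReal.ofReal (Real.pi ^ ((n + 1) / 2 : ℝ)) * (A * ENNReal.ofReal (1 / |ξ j|))) := by
        gcongr
        · rw [← mul_pow, ENNReal.ofReal_pow (by positivity), ← ofReal_norm, norm_mul,
            Complex.norm_real, Real.norm_eq_abs]
        · exact hA j ξ hξ
    _ = (ENNReal.ofReal (Real.pi ^ ((n + 1) / 2 : ℝ)) * A) *
        ENNReal.ofReal (|ξ j| * ‖S ξ‖ ^ 2) := by
        have : |ξ j| * ‖S ξ‖ ^ 2 = |ξ j| ^ 2 * ‖S ξ‖ ^ 2 * (1 / |ξ j|) := by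
          have := abs_pos.2 hξ
          field_simp
        rw [this, ENNReal.ofReal_mul (p := _ * _) (by positivity)]
        ring
    _ ≤ _ := by
        rw [ENNReal.coe_mul]
        change _ ≤ ENNReal.ofReal _ * _ * _
        gcongr
        rw [← Real.sqrt_eq_rpow]
        refine Real.le_sqrt_of_sq_le ?_
        have := hcoord ξ
        nlinarith [abs_nonneg (ξ j)]

theorem enorm_gradNormSq_schrodSol_le {n : ℕ} (u : SchwartzMap (EuclideanSpace ℝ (Fin n)) ℂ)
    {R T t : ℝ} (ht : t ∈ Set.Ioc 0 T) {x : EuclideanSpace ℝ (Fin n)} (hx : ‖x‖ ≤ R) :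
    ‖gradNormSq (schrodSol u t) x‖ₑ ≤
      ENNReal.ofReal (((2 * Real.pi) ^ (-(n : ℝ) / 2)) ^ 2 * Real.exp (T ^ 2 + R ^ 2)) *
        ∑ j, ENNReal.ofReal (gaussianWeight (t, x)) *
          ‖∫ ξ, Complex.exp (Complex.I * schrodPhase (t, x) ξ) * (ξ j * fourierT u ξ)‖ₑ ^ 2 := by
  have hw : 1 ≤ Real.exp (T ^ 2 + R ^ 2) * gaussianWeight (t, x) := by
    rw [gaussianWeight, ← Real.exp_add, ← Real.exp_add]
    refine Real.one_le_exp ?_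
    have h1 : ‖t‖ ^ 2 ≤ T ^ 2 := by
      rw [Real.norm_of_nonneg ht.1.le]
      exact pow_le_pow_left₀ ht.1.le ht.2 2
    have h2 : ‖x‖ ^ 2 ≤ R ^ 2 := by gcongr
    linarith
  have hw0 : 0 ≤ gaussianWeight (t, x) := by unfold gaussianWeight; positivity
  simp_rw [← ofReal_norm, ← ENNReal.ofReal_pow (norm_nonneg _), ← ENNReal.ofReal_mul hw0]
  rw [← ENNReal.ofReal_sum_of_nonneg fun j _ => by positivity,
    ← ENNReal.ofReal_mul (by positivity)]
  refine ENNReal.ofReal_le_ofReal ?_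
  rw [gradNormSq, Real.norm_of_nonneg (by positivity), Finset.mul_sum]
  refine Finset.sum_le_sum fun j _ => ?_
  refine (pow_le_pow_left₀ (norm_nonneg _) (norm_fderiv_schrodSol_le u t x j) 2).trans ?_
  rw [mul_pow]
  refine (le_mul_of_one_le_right (by positivity) hw).trans_eq ?_
  ring

theorem lintegral_lintegral_const_mul_sum {α β ι : Type*} [MeasurableSpace α] [MeasurableSpace β]
    {μ : Measure α} {ν : Measure β} [SFinite ν] (s : Finset ι) {J : ι → α × β → ENNReal}
    (hJ : ∀ i, Measurable (J i)) {c : ENNReal} (hc : c ≠ ⊤) :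
    ∫⁻ a, ∫⁻ b, c * ∑ i ∈ s, J i (a, b) ∂ν ∂μ = c * ∑ i ∈ s, ∫⁻ v, J i v ∂(μ.prod ν) := by
  rw [← lintegral_finsetSum _ fun i _ => hJ i, ← lintegral_const_mul' _ _ hc,
    lintegral_prod _ (by fun_prop)]

/-- **Local smoothing estimate** for the free Schrödinger equation in dimension `n ≥ 4`:
for every `R > 0` and `T > 0` there is `C = C(n,R,T)` such that for all Schwartz data `ψ₀`,
`∫₀^T ∫_{|x|≤R} |∇ψ(t,x)|² dx dt ≤ C ‖ψ₀‖²_{H^{1/2}}`. -/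
theorem local_smoothing_estimate (n : ℕ) (hn : 4 ≤ n) (R T : ℝ) (hR : 0 < R) (hT : 0 < T) :
    ∃ C : ℝ, ∀ ψ₀ : SchwartzMap (EuclideanSpace ℝ (Fin n)) ℂ,
      (∫ t in Set.Ioc (0 : ℝ) T,
          ∫ x in {x : EuclideanSpace ℝ (Fin n) | ‖x‖ ≤ R}, gradNormSq (schrodSol ψ₀ t) x)
        ≤ C * sobolevNormSq ((1 : ℝ) / 2) (⇑ψ₀) := by
  obtain ⟨B, hB⟩ := exists_lintegral_weight_le n
  set c := ((2 * Real.pi) ^ (-(n : ℝ) / 2)) ^ 2 * Real.exp (T ^ 2 + R ^ 2)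
  refine ⟨c * (n * B), fun u => ?_⟩
  have hSob : 0 ≤ sobolevNormSq (1 / 2) u := integral_nonneg fun ξ => by positivity
  set J : Fin n → ℝ × EuclideanSpace ℝ (Fin n) → ENNReal := fun j v =>
    ENNReal.ofReal (gaussianWeight v) *
      ‖∫ ξ, Complex.exp (Complex.I * schrodPhase v ξ) * (ξ j * fourierT u ξ)‖ₑ ^ 2
  have hJmeas : ∀ j, Measurable (J j) := fun j => by
    obtain ⟨S, hS⟩ := exists_schwartzMap_eq_fourierT u
    have h1 : Continuous (gaussianWeight (n := n)) := by unfold gaussianWeight; fun_prop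
    have h2 : StronglyMeasurable fun v : ℝ × EuclideanSpace ℝ (Fin n) =>
        ∫ ξ, Complex.exp (Complex.I * schrodPhase v ξ) * (ξ j * fourierT u ξ) := by
      refine StronglyMeasurable.integral_prod_right (f := fun v ξ =>
        Complex.exp (Complex.I * schrodPhase v ξ) * (ξ j * fourierT u ξ)) ?_
      rw [hS]
      refine Continuous.stronglyMeasurable ?_
      have := continuous_schrodPhase (n := n)
      unfold Function.uncurry at this ⊢
      fun_prop
    exact h1.measurable.ennreal_ofReal.mul (h2.measurable.enorm.pow_const 2)
  have hmain : ‖∫ t in Set.Ioc (0 : ℝ) T, ∫ x in {x : EuclideanSpace ℝ (Fin n) | ‖x‖ ≤ R},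
      gradNormSq (schrodSol u t) x‖ₑ ≤
      ENNReal.ofReal (c * (n * B) * sobolevNormSq (1 / 2) u) := by
    calc _ ≤ ∫⁻ t in Set.Ioc (0 : ℝ) T, ∫⁻ x in {x : EuclideanSpace ℝ (Fin n) | ‖x‖ ≤ R},
          ‖gradNormSq (schrodSol u t) x‖ₑ :=
          (enorm_integral_le_lintegral_enorm _).trans
            (lintegral_mono fun t => enorm_integral_le_lintegral_enorm _)
      _ ≤ ∫⁻ t in Set.Ioc (0 : ℝ) T, ∫⁻ x in {x : EuclideanSpace ℝ (Fin n) | ‖x‖ ≤ R},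
          ENNReal.ofReal c * ∑ j, J j (t, x) := by
          refine setLIntegral_mono' measurableSet_Ioc fun t ht => ?_
          exact setLIntegral_mono' (measurableSet_le measurable_norm measurable_const)
            fun x hx => enorm_gradNormSq_schrodSol_le u ht hx
      _ ≤ ∫⁻ t, ∫⁻ x, ENNReal.ofReal c * ∑ j, J j (t, x) :=
          (setLIntegral_le_lintegral _ _).trans
            (lintegral_mono fun t => setLIntegral_le_lintegral _ _)
      _ = ENNReal.ofReal c * ∑ j, ∫⁻ v, J j v := by
          exact lintegral_lintegral_const_mul_sum Finset.univ hJmeas ENNReal.ofReal_ne_top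
      _ ≤ ENNReal.ofReal c * ∑ _j : Fin n, B * ENNReal.ofReal (sobolevNormSq (1 / 2) u) := by
          exact mul_le_mul_right (Finset.sum_le_sum fun j _ => hB u j) _
      _ = _ := by
          rw [mul_assoc c, ENNReal.ofReal_mul (p := c) (by positivity), mul_assoc,
            ENNReal.ofReal_mul (Nat.cast_nonneg n), ENNReal.ofReal_mul B.coe_nonneg]
          simp
  rw [← ofReal_norm, ENNReal.ofReal_le_ofReal_iff (by positivity)] at hmain
  exact (le_abs_self _).trans hmain
end

section
/- Let n ≥ 1, let u : ℝ × ℝⁿ → ℝ be a smooth solution of the wave equation ∂_t² u(t,x) = Σ_{j=1}^n ∂²u/∂x_j²(t,x), let x₀ ∈ ℝⁿ and R > 0, and suppose the Cauchy data vanish on the ball of radius R about x₀: u(0,x) = 0 and ∂_t u(0,x) = 0 whenever |x − x₀| ≤ R. Then u vanishes on the backward/forward light cone over this ball: u(t,x) = 0 whenever |t| ≤ R and |x − x₀| ≤ R − |t| (finite propagation speed). -/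
open MeasureTheory Set Filter Topology Metric

section SpaceTime

variable {E : Type*} [NormedAddCommGroup E] [InnerProductSpace ℝ E]

/-- The time derivative of a differentiable function on space-time. -/
lemma hasDerivAt_comp_prodMk_left {G : ℝ × E → ℝ} {t : ℝ} {x : E}
    (hG : DifferentiableAt ℝ G (t, x)) :
    HasDerivAt (fun s => G (s, x)) (fderiv ℝ G (t, x) (1, 0)) t :=
  hG.hasFDerivAt.comp_hasDerivAt t ((hasDerivAt_id t).prodMk (hasDerivAt_const t x))

/-- The spatial derivative of a differentiable function on space-time. -/
lemma fderiv_comp_prodMk_right {G : ℝ × E → ℝ} {t : ℝ} {x : E}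
    (hG : DifferentiableAt ℝ G (t, x)) (v : E) :
    fderiv ℝ (fun y => G (t, y)) x v = fderiv ℝ G (t, x) (0, v) := by
  have h := hG.hasFDerivAt.comp x (hasFDerivAt_prodMk_right t x)
  rw [show (fun y => G (t, y)) = G ∘ (fun y => (t, y)) from rfl, h.fderiv]
  simp

lemma continuous_fderiv_apply_of_contDiff {F : Type*} [NormedAddCommGroup F] [NormedSpace ℝ F]
    {G : F → ℝ} (hG : ContDiff ℝ 1 G) (v : F) :
    Continuous (fun p => fderiv ℝ G p v) :=
  (hG.continuous_fderiv one_ne_zero).clm_apply continuous_const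

/-- A function vanishing outside a ball uniformly for `t` in an open set
has derivatives with the same property. -/
lemma fderiv_eq_zero_of_forall_eq_zero {G : ℝ × E → ℝ} {I : Set ℝ} (hI : IsOpen I) {x₀ : E} {ρ : ℝ}
    (hsupp : ∀ t ∈ I, ∀ x, ρ < ‖x - x₀‖ → G (t, x) = 0) {t : ℝ} (ht : t ∈ I) {x : E}
    (hx : ρ < ‖x - x₀‖) : fderiv ℝ G (t, x) = 0 := by
  have h : G =ᶠ[𝓝 (t, x)] fun _ => 0 := by
    have h1 : ∀ᶠ p : ℝ × E in 𝓝 (t, x), p.1 ∈ I :=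
      continuous_fst.continuousAt.eventually (hI.mem_nhds ht)
    have h2 : ∀ᶠ p : ℝ × E in 𝓝 (t, x), ρ < ‖p.2 - x₀‖ :=
      (isOpen_lt continuous_const (by fun_prop :
        Continuous fun p : ℝ × E => ‖p.2 - x₀‖)).mem_nhds hx
    filter_upwards [h1, h2] with p hp1 hp2
    exact hsupp p.1 hp1 p.2 hp2
  rw [h.fderiv_eq, fderiv_fun_const]
  rfl

variable [FiniteDimensional ℝ E]

lemma hasCompactSupport_of_forall_eq_zero {f : E → ℝ} {x₀ : E} {ρ : ℝ}
    (hf : ∀ x, ρ < ‖x - x₀‖ → f x = 0) : HasCompactSupport f := by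
  refine HasCompactSupport.intro (isCompact_closedBall x₀ ρ) fun x hx => hf x ?_
  rw [mem_closedBall, dist_eq_norm, not_le] at hx
  exact hx

variable [MeasurableSpace E] [BorelSpace E]

/-- Differentiation under the integral sign for functions with compact spatial support. -/
lemma hasDerivAt_integral_of_forall_eq_zero {G : ℝ × E → ℝ} (hG : ContDiff ℝ 1 G) {I : Set ℝ}
    (hI : IsOpen I) {x₀ : E} {ρ : ℝ}
    (hsupp : ∀ t ∈ I, ∀ x, ρ < ‖x - x₀‖ → G (t, x) = 0) {t : ℝ} (ht : t ∈ I) :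
    HasDerivAt (fun s => ∫ x, G (s, x)) (∫ x, fderiv ℝ G (t, x) (1, 0)) t := by
  obtain ⟨ε, hε, hεI⟩ := nhds_basis_closedBall.mem_iff.1 (hI.mem_nhds ht)
  have hcont := continuous_fderiv_apply_of_contDiff hG ((1 : ℝ), (0 : E))
  obtain ⟨C, hC⟩ := ((isCompact_closedBall t ε).prod
    (isCompact_closedBall x₀ ρ)).exists_bound_of_continuousOn hcont.continuousOn
  refine (hasDerivAt_integral_of_dominated_loc_of_deriv_le
    (F := fun s x => G (s, x)) (F' := fun s x => fderiv ℝ G (s, x) (1, 0))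
    (bound := (closedBall x₀ ρ).indicator fun _ => C)
    (closedBall_mem_nhds t hε) ?_ ?_ ?_ ?_ ?_ ?_).2
  · exact Eventually.of_forall fun s =>
      (hG.continuous.comp (Continuous.prodMk_right s)).aestronglyMeasurable
  · exact (hG.continuous.comp (Continuous.prodMk_right t)).integrable_of_hasCompactSupport
      (hasCompactSupport_of_forall_eq_zero (hsupp t ht))
  · exact (hcont.comp (Continuous.prodMk_right t)).aestronglyMeasurable
  · refine Eventually.of_forall fun x s hs => ?_
    by_cases hx : x ∈ closedBall x₀ ρ
    · rw [indicator_of_mem hx]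
      exact hC (s, x) ⟨hs, hx⟩
    · rw [indicator_of_notMem hx]
      rw [mem_closedBall, dist_eq_norm, not_le] at hx
      simp [fderiv_eq_zero_of_forall_eq_zero hI hsupp (hεI hs) hx]
  · exact (integrable_indicator_iff measurableSet_closedBall).2
      (integrableOn_const measure_closedBall_lt_top.ne)
  · exact Eventually.of_forall fun x s _ =>
      hasDerivAt_comp_prodMk_left (hG.differentiable one_ne_zero _)

/-- The integral of a derivative of a compactly supported function vanishes. -/
lemma integral_fderiv_apply_eq_zero {f : E → ℝ} (hf : ContDiff ℝ 1 f) (hsupp : HasCompactSupport f)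
    (v : E) : ∫ x, fderiv ℝ f x v = 0 := by
  have h := integral_mul_fderiv_eq_neg_fderiv_mul_of_integrable (μ := volume) (f := f)
    (g := fun _ => (1 : ℝ)) (v := v) ?_ ?_ ?_ ?_ ?_
  · simpa using h
  · simpa using (continuous_fderiv_apply_of_contDiff hf v).integrable_of_hasCompactSupport
      (hsupp.fderiv_apply (𝕜 := ℝ) v)
  · simp
  · simpa using hf.continuous.integrable_of_hasCompactSupport hsupp
  · exact fun x _ => hf.differentiable one_ne_zero x
  · exact fun x _ => differentiableAt_const _

end SpaceTime

section Cone

variable {n : ℕ}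

/-- A smooth weight which is positive exactly inside the (double) light cone over
the ball of radius `R` about `x₀`. -/
noncomputable def coneWeight (x₀ : EuclideanSpace ℝ (Fin n)) (R : ℝ)
    (p : ℝ × EuclideanSpace ℝ (Fin n)) : ℝ :=
  expNegInvGlue ((R - p.1) ^ 2 - ‖p.2 - x₀‖ ^ 2)

lemma contDiff_coneWeight (x₀ : EuclideanSpace ℝ (Fin n)) (R : ℝ) :
    ContDiff ℝ 1 (coneWeight x₀ R) := by
  have h : ContDiff ℝ 1 fun p : ℝ × EuclideanSpace ℝ (Fin n) =>
      (R - p.1) ^ 2 - ‖p.2 - x₀‖ ^ 2 :=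
    ((contDiff_const.sub contDiff_fst).pow 2).sub ((contDiff_snd.sub contDiff_const).norm_sq ℝ)
  exact (expNegInvGlue.contDiff (n := 1)).comp h

lemma fderiv_coneWeight (x₀ : EuclideanSpace ℝ (Fin n)) (R : ℝ)
    (p : ℝ × EuclideanSpace ℝ (Fin n)) (s : ℝ) (v : EuclideanSpace ℝ (Fin n)) :
    fderiv ℝ (coneWeight x₀ R) p (s, v) =
      deriv expNegInvGlue ((R - p.1) ^ 2 - ‖p.2 - x₀‖ ^ 2) *
        (-2 * (R - p.1) * s - 2 * inner ℝ (p.2 - x₀) v) := by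
  have h1 : HasFDerivAt (fun p : ℝ × EuclideanSpace ℝ (Fin n) => (R - p.1) ^ 2) _ p :=
    ((hasFDerivAt_fst (𝕜 := ℝ) (p := p)).const_sub R).pow 2
  have h2 : HasFDerivAt (fun p : ℝ × EuclideanSpace ℝ (Fin n) => ‖p.2 - x₀‖ ^ 2) _ p :=
    ((hasFDerivAt_snd (𝕜 := ℝ) (p := p)).sub_const x₀).norm_sq
  have h3 : HasDerivAt expNegInvGlue
      (deriv expNegInvGlue ((R - p.1) ^ 2 - ‖p.2 - x₀‖ ^ 2)) ((R - p.1) ^ 2 - ‖p.2 - x₀‖ ^ 2) :=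
    ((expNegInvGlue.contDiff (n := 1)).differentiable one_ne_zero _).hasDerivAt
  have h : HasFDerivAt (coneWeight x₀ R) _ p := h3.comp_hasFDerivAt p (h1.sub h2)
  rw [h.fderiv]
  simp [inner_sub_left]

lemma deriv_expNegInvGlue_nonneg (s : ℝ) : 0 ≤ deriv expNegInvGlue s :=
  expNegInvGlue.monotone.deriv_nonneg

lemma deriv_expNegInvGlue_of_neg {s : ℝ} (hs : s < 0) : deriv expNegInvGlue s = 0 := by
  have h : expNegInvGlue =ᶠ[𝓝 s] fun _ => 0 := by
    filter_upwards [gt_mem_nhds hs] with r hr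
    exact expNegInvGlue.zero_of_nonpos hr.le
  rw [h.deriv_eq, deriv_const]

/-- The energy flux through the boundary of a light cone is dominated by the energy density. -/
lemma two_mul_sum_mul_le_mul_add_sum_sq {r α : ℝ} (y : EuclideanSpace ℝ (Fin n)) (hy : ‖y‖ ≤ r)
    (β : Fin n → ℝ) :
    2 * ∑ j, y j * (α * β j) ≤ r * (α ^ 2 + ∑ j, β j ^ 2) := by
  have hr : 0 ≤ r := (norm_nonneg y).trans hy
  have hyr : ∑ j, y j ^ 2 ≤ r ^ 2 := by
    rw [← EuclideanSpace.real_norm_sq_eq]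
    gcongr
  have hcs := Finset.sum_mul_sq_le_sq_mul_sq Finset.univ (fun j => y j) β
  set S := ∑ j, y j * β j
  set B := ∑ j, β j ^ 2
  have hB : 0 ≤ B := Finset.sum_nonneg fun j _ => sq_nonneg _
  have hS : ∑ j, y j * (α * β j) = α * S := by
    rw [Finset.mul_sum]
    exact Finset.sum_congr rfl fun j _ => by ring
  rw [hS]
  have h1 : S ^ 2 ≤ r ^ 2 * B := hcs.trans (by gcongr)
  refine abs_le_of_sq_le_sq' ?_ (by positivity) |>.2
  nlinarith [mul_nonneg (sq_nonneg r) (sq_nonneg (α ^ 2 - B)),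
    mul_le_mul_of_nonneg_left h1 (sq_nonneg α)]

/-- Domain of dependence for the first-order symmetric system `∂ₜ a = ∑ ∂ⱼ bⱼ`, `∂ₜ bⱼ = ∂ⱼ a`,
proved by the energy method. -/
theorem eq_zero_of_firstOrder_system {a : ℝ × EuclideanSpace ℝ (Fin n) → ℝ}
    {b : Fin n → ℝ × EuclideanSpace ℝ (Fin n) → ℝ}
    (ha : ContDiff ℝ 1 a) (hb : ∀ j, ContDiff ℝ 1 (b j))
    (hat : ∀ p, fderiv ℝ a p (1, 0) =
      ∑ j, fderiv ℝ (b j) p (0, EuclideanSpace.single j (1 : ℝ)))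
    (hbt : ∀ j p, fderiv ℝ (b j) p (1, 0) = fderiv ℝ a p (0, EuclideanSpace.single j (1 : ℝ)))
    {x₀ : EuclideanSpace ℝ (Fin n)} {R : ℝ}
    (ha0 : ∀ x, ‖x - x₀‖ < R → a (0, x) = 0) (hb0 : ∀ j x, ‖x - x₀‖ < R → b j (0, x) = 0)
    {t : ℝ} (ht : 0 ≤ t) {x : EuclideanSpace ℝ (Fin n)} (hx : ‖x - x₀‖ < R - t) :
    a (t, x) = 0 := by
  have hR : 0 < R := by linarith [norm_nonneg (x - x₀)]
  set e : ℝ × EuclideanSpace ℝ (Fin n) → ℝ := fun p => a p ^ 2 + ∑ j, b j p ^ 2 with he_def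
  set w := coneWeight x₀ R
  have he : ContDiff ℝ 1 e := (ha.pow 2).add (ContDiff.sum fun j _ => (hb j).pow 2)
  have hw : ContDiff ℝ 1 w := contDiff_coneWeight x₀ R
  have he_nonneg : ∀ p, 0 ≤ e p := fun p => by positivity
  have hw_nonneg : ∀ p, 0 ≤ w p := fun p => expNegInvGlue.nonneg _
  set I := Ioo (-1) (R + 1)
  have hI : IsOpen I := isOpen_Ioo
  have hw_supp : ∀ s ∈ I, ∀ y, R + 1 < ‖y - x₀‖ → w (s, y) = 0 := by
    intro s hs y hy
    refine expNegInvGlue.zero_of_nonpos ?_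
    have : (R - s) ^ 2 ≤ ‖y - x₀‖ ^ 2 :=
      sq_le_sq' (by linarith [hs.2]) (by linarith [hs.1])
    simpa using this
  have hwe : ContDiff ℝ 1 fun p => w p * e p := hw.mul he
  have hflux : ∀ j, ContDiff ℝ 1 fun p => w p * (a p * b j p) := fun j => hw.mul (ha.mul (hb j))
  have hpoint : ∀ p : ℝ × EuclideanSpace ℝ (Fin n), p.1 ≤ R →
      fderiv ℝ (fun p => w p * e p) p (1, 0) ≤
      2 * ∑ j, fderiv ℝ (fun p => w p * (a p * b j p)) p (0, EuclideanSpace.single j (1 : ℝ)) := by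
    intro p hp
    have dw := (hw.differentiable one_ne_zero p).hasFDerivAt
    have da := (ha.differentiable one_ne_zero p).hasFDerivAt
    have db := fun j => ((hb j).differentiable one_ne_zero p).hasFDerivAt
    have de : HasFDerivAt e _ p := (da.pow 2).add (HasFDerivAt.fun_sum fun j _ => (db j).pow 2)
    have hl := (dw.mul de).fderiv
    have hr := fun j => (dw.mul (da.mul (db j))).fderiv
    have hl' : fderiv ℝ (fun p => w p * e p) p (1, 0) =
        fderiv ℝ w p (1, 0) * e p + 2 * w p * (a p * fderiv ℝ a p (1, 0) +
          ∑ j, b j p * fderiv ℝ (b j) p (1, 0)) := by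
      refine (congrArg (fun L => L (1, 0)) hl).trans ?_
      simp [Finset.mul_sum, mul_add]
      ring_nf
    have hr' : ∀ j v, fderiv ℝ (fun p => w p * (a p * b j p)) p v =
        fderiv ℝ w p v * (a p * b j p) +
          w p * (a p * fderiv ℝ (b j) p v + b j p * fderiv ℝ a p v) := by
      intro j v
      refine (congrArg (fun L => L v) (hr j)).trans ?_
      simp
      ring
    have hinner : ∀ j, inner ℝ (p.2 - x₀) (EuclideanSpace.single j (1 : ℝ)) = (p.2 - x₀) j := by
      intro j
      simp [EuclideanSpace.inner_single_right]
    have hfw : ∀ r v, fderiv ℝ w p (r, v) = _ := fderiv_coneWeight x₀ R p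
    simp only [hl', hr', hat, hbt, hfw, hinner, Finset.sum_add_distrib, ← Finset.mul_sum]
    set D := deriv expNegInvGlue ((R - p.1) ^ 2 - ‖p.2 - x₀‖ ^ 2)
    have key : D * (2 * ∑ j, (p.2 - x₀) j * (a p * b j p)) ≤ D * ((R - p.1) * e p) := by
      rcases lt_or_ge (R - p.1) ‖p.2 - x₀‖ with h | h
      · have : D = 0 := deriv_expNegInvGlue_of_neg (by
          have := sub_nonneg.2 hp
          nlinarith)
        simp [this]
      · exact mul_le_mul_of_nonneg_left (two_mul_sum_mul_le_mul_add_sum_sq _ h _)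
          (deriv_expNegInvGlue_nonneg _)
    have hsum : ∑ j, D * (-2 * (R - p.1) * 0 - 2 * (p.2 - x₀) j) * (a p * b j p) =
        -(D * (2 * ∑ j, (p.2 - x₀) j * (a p * b j p))) := by
      simp only [Finset.mul_sum, ← Finset.sum_neg_distrib]
      exact Finset.sum_congr rfl fun j _ => by ring
    rw [hsum]
    simp only [inner_zero_right, mul_zero, mul_one, sub_zero]
    linarith
  have hderiv : ∀ s ∈ I, HasDerivAt (fun s => ∫ y, w (s, y) * e (s, y))
      (∫ y, fderiv ℝ (fun p => w p * e p) (s, y) (1, 0)) s := fun s hs =>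
    hasDerivAt_integral_of_forall_eq_zero hwe hI (x₀ := x₀) (ρ := R + 1)
      (fun s hs y hy => by simp [hw_supp s hs y hy]) hs
  have hderiv_nonpos : ∀ s ∈ I, s ≤ R →
      ∫ y, fderiv ℝ (fun p => w p * e p) (s, y) (1, 0) ≤ 0 := by
    intro s hs hsR
    have hint : ∀ (G : ℝ × EuclideanSpace ℝ (Fin n) → ℝ) (v), ContDiff ℝ 1 G →
        (∀ s ∈ I, ∀ y, R + 1 < ‖y - x₀‖ → G (s, y) = 0) →
        Integrable fun y => fderiv ℝ G (s, y) v := fun G v hG hsupp =>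
      ((continuous_fderiv_apply_of_contDiff hG v).comp
        (Continuous.prodMk_right s)).integrable_of_hasCompactSupport
        (hasCompactSupport_of_forall_eq_zero (x₀ := x₀) (ρ := R + 1) fun y hy => by
          simp [fderiv_eq_zero_of_forall_eq_zero hI hsupp hs hy])
    have hflux_supp : ∀ j, ∀ s ∈ I, ∀ y, R + 1 < ‖y - x₀‖ →
        w (s, y) * (a (s, y) * b j (s, y)) = 0 := fun j s hs y hy => by simp [hw_supp s hs y hy]
    have hflux_int := fun j => hint _ ((0 : ℝ), EuclideanSpace.single j (1 : ℝ)) (hflux j)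
      (hflux_supp j)
    calc ∫ y, fderiv ℝ (fun p => w p * e p) (s, y) (1, 0)
        ≤ ∫ y, 2 * ∑ j, fderiv ℝ (fun p => w p * (a p * b j p)) (s, y)
            (0, EuclideanSpace.single j (1 : ℝ)) :=
          integral_mono
            (hint _ _ hwe fun s hs y hy => by simp [hw_supp s hs y hy])
            ((integrable_finsetSum _ fun j _ => hflux_int j).const_mul 2)
            fun y => hpoint (s, y) hsR
      _ = 0 := by
          rw [integral_const_mul, integral_finsetSum _ fun j _ => hflux_int j]
          refine mul_eq_zero_of_right _ (Finset.sum_eq_zero fun j _ => ?_)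
          refine Eq.trans ?_ (integral_fderiv_apply_eq_zero
            ((hflux j).comp (contDiff_prodMk_right s))
            (hasCompactSupport_of_forall_eq_zero (hflux_supp j s hs))
            (EuclideanSpace.single j (1 : ℝ)))
          refine integral_congr_ae (Eventually.of_forall fun y => ?_)
          exact (fderiv_comp_prodMk_right ((hflux j).differentiable one_ne_zero (s, y))
            (EuclideanSpace.single j (1 : ℝ))).symm
  have htR : t ≤ R := by linarith [norm_nonneg (x - x₀)]
  have hIcc : Icc 0 R ⊆ I := fun s hs => ⟨by linarith [hs.1], by linarith [hs.2]⟩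
  have hanti : AntitoneOn (fun s => ∫ y, w (s, y) * e (s, y)) (Icc 0 R) := by
    refine antitoneOn_of_deriv_nonpos (convex_Icc 0 R)
      (fun s hs => (hderiv s (hIcc hs)).continuousAt.continuousWithinAt)
      (fun s hs => (hderiv s (hIcc (interior_subset hs))).differentiableAt.differentiableWithinAt)
      fun s hs => ?_
    have hs' := interior_subset hs
    rw [(hderiv s (hIcc hs')).deriv]
    exact hderiv_nonpos s (hIcc hs') hs'.2
  have hzero : ∫ y, w (0, y) * e (0, y) = 0 := by
    have : ∀ y, w (0, y) * e (0, y) = 0 := by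
      intro y
      rcases lt_or_ge ‖y - x₀‖ R with h | h
      · simp [he_def, ha0 y h, fun j => hb0 j y h]
      · refine mul_eq_zero_of_left (expNegInvGlue.zero_of_nonpos ?_) _
        simpa using pow_le_pow_left₀ hR.le h 2
    simp [this]
  have hle : ∫ y, w (t, y) * e (t, y) ≤ 0 :=
    (hanti ⟨le_rfl, hR.le⟩ ⟨ht, htR⟩ ht).trans hzero.le
  have hcont : Continuous fun y => w (t, y) * e (t, y) :=
    hwe.continuous.comp (Continuous.prodMk_right t)
  have hnonneg : ∀ y, 0 ≤ w (t, y) * e (t, y) := fun y => mul_nonneg (hw_nonneg _) (he_nonneg _)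
  have hint : Integrable fun y => w (t, y) * e (t, y) :=
    hcont.integrable_of_hasCompactSupport
      (hasCompactSupport_of_forall_eq_zero (x₀ := x₀) (ρ := R + 1) fun y hy => by
        simp [hw_supp t (hIcc ⟨ht, htR⟩) y hy])
  have hae := (integral_eq_zero_iff_of_nonneg hnonneg hint).1
    (hle.antisymm (integral_nonneg hnonneg))
  have hwe0 : w (t, x) * e (t, x) = 0 :=
    congrFun ((hcont.ae_eq_iff_eq volume continuous_const).1 hae) x
  have hwpos : 0 < w (t, x) := by
    refine expNegInvGlue.pos_of_pos (sub_pos.2 ?_)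
    exact pow_lt_pow_left₀ hx (norm_nonneg _) two_ne_zero
  have he0 : a (t, x) ^ 2 + ∑ j, b j (t, x) ^ 2 = 0 := (mul_eq_zero.1 hwe0).resolve_left hwpos.ne'
  have hb_nonneg : 0 ≤ ∑ j, b j (t, x) ^ 2 := Finset.sum_nonneg fun j _ => sq_nonneg _
  exact pow_eq_zero_iff two_ne_zero |>.1 (by linarith [sq_nonneg (a (t, x))])

/-- Solutions of the wave equation with vanishing Cauchy data vanish in the open forward cone. -/
theorem wave_eq_zero_of_nonneg {u : ℝ → EuclideanSpace ℝ (Fin n) → ℝ}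
    (hsmooth : ContDiff ℝ (⊤ : ℕ∞) (fun p : ℝ × EuclideanSpace ℝ (Fin n) => u p.1 p.2))
    (hwave : ∀ (t : ℝ) (x : EuclideanSpace ℝ (Fin n)),
      deriv (fun s => deriv (fun r => u r x) s) t
        = ∑ j : Fin n,
            fderiv ℝ (fun y => fderiv ℝ (u t) y (EuclideanSpace.single j (1 : ℝ))) x
              (EuclideanSpace.single j (1 : ℝ)))
    {x₀ : EuclideanSpace ℝ (Fin n)} {R : ℝ}
    (hdata₀ : ∀ x, ‖x - x₀‖ < R → u 0 x = 0)
    (hdata₁ : ∀ x, ‖x - x₀‖ < R → deriv (fun s => u s x) 0 = 0)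
    {t : ℝ} (ht : 0 ≤ t) {x : EuclideanSpace ℝ (Fin n)} (hx : ‖x - x₀‖ < R - t) : u t x = 0 := by
  set U : ℝ × EuclideanSpace ℝ (Fin n) → ℝ := fun p => u p.1 p.2
  have hU₂ : ContDiff ℝ 2 U := contDiff_infty.1 hsmooth 2
  have hU : Differentiable ℝ U := hU₂.differentiable two_ne_zero
  have hU' : ContDiff ℝ 1 (fderiv ℝ U) := hU₂.fderiv_right (by norm_num)
  have hdir : ∀ v, ContDiff ℝ 1 fun p => fderiv ℝ U p v := fun v =>
    hU'.clm_apply contDiff_const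
  have hsecond : ∀ p v v', fderiv ℝ (fun q => fderiv ℝ U q v) p v' =
      fderiv ℝ (fderiv ℝ U) p v' v := by
    intro p v v'
    have hd : DifferentiableAt ℝ (fderiv ℝ U) p :=
      hU'.differentiable one_ne_zero p
    rw [fderiv_clm_apply hd (differentiableAt_const v)]
    simp
  have hsymm : ∀ p v v', fderiv ℝ (fun q => fderiv ℝ U q v) p v' =
      fderiv ℝ (fun q => fderiv ℝ U q v') p v := fun p v v' => by
    rw [hsecond, hsecond]
    exact hU₂.contDiffAt.isSymmSndFDerivAt (by simp) v' v
  have hut : ∀ s y, HasDerivAt (fun r => u r y) (fderiv ℝ U (s, y) (1, 0)) s := fun s y =>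
    hasDerivAt_comp_prodMk_left (hU (s, y))
  have huj : ∀ s y v, fderiv ℝ (u s) y v = fderiv ℝ U (s, y) (0, v) := fun s y v =>
    fderiv_comp_prodMk_right (hU (s, y)) v
  have hvel : ∀ s, 0 ≤ s → ∀ y, ‖y - x₀‖ < R - s → fderiv ℝ U (s, y) (1, 0) = 0 := by
    intro s hs y hy
    refine eq_zero_of_firstOrder_system (a := fun p => fderiv ℝ U p (1, 0))
      (b := fun j p => fderiv ℝ U p (0, EuclideanSpace.single j (1 : ℝ)))
      (hdir _) (fun j => hdir _) ?_ (fun j p => hsymm p _ _) ?_ ?_ hs hy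
    · rintro ⟨r, z⟩
      have h := hwave r z
      simp only [(hut _ _).deriv, huj] at h
      rw [(hasDerivAt_comp_prodMk_left ((hdir _).differentiable one_ne_zero _)).deriv] at h
      refine h.trans (Finset.sum_congr rfl fun j _ => ?_)
      exact fderiv_comp_prodMk_right ((hdir _).differentiable one_ne_zero _) _
    · intro z hz
      rw [← (hut 0 z).deriv, hdata₁ z hz]
    · intro j z hz
      have h : u 0 =ᶠ[𝓝 z] fun _ => 0 := by
        filter_upwards [(isOpen_lt (by fun_prop : Continuous
          fun z : EuclideanSpace ℝ (Fin n) => ‖z - x₀‖) continuous_const).mem_nhds hz] with q hq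
        exact hdata₀ q hq
      rw [← huj, h.fderiv_eq, fderiv_fun_const]
      rfl
  have hconst : ∀ s ∈ Icc 0 t, u s x = u 0 x :=
    constant_of_has_deriv_right_zero
      (fun s _ => (hut s x).continuousAt.continuousWithinAt) fun s hs => by
        rw [← hvel s hs.1 x (by linarith [hs.2])]
        exact (hut s x).hasDerivWithinAt
  rw [hconst t ⟨ht, le_rfl⟩]
  exact hdata₀ x (by linarith)

/-- Solutions of the wave equation with vanishing Cauchy data vanish in the open double cone. -/
theorem wave_eq_zero_of_norm_lt {u : ℝ → EuclideanSpace ℝ (Fin n) → ℝ}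
    (hsmooth : ContDiff ℝ (⊤ : ℕ∞) (fun p : ℝ × EuclideanSpace ℝ (Fin n) => u p.1 p.2))
    (hwave : ∀ (t : ℝ) (x : EuclideanSpace ℝ (Fin n)),
      deriv (fun s => deriv (fun r => u r x) s) t
        = ∑ j : Fin n,
            fderiv ℝ (fun y => fderiv ℝ (u t) y (EuclideanSpace.single j (1 : ℝ))) x
              (EuclideanSpace.single j (1 : ℝ)))
    {x₀ : EuclideanSpace ℝ (Fin n)} {R : ℝ}
    (hdata₀ : ∀ x, ‖x - x₀‖ < R → u 0 x = 0)
    (hdata₁ : ∀ x, ‖x - x₀‖ < R → deriv (fun s => u s x) 0 = 0)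
    {t : ℝ} {x : EuclideanSpace ℝ (Fin n)} (hx : ‖x - x₀‖ < R - |t|) : u t x = 0 := by
  rcases le_total 0 t with ht | ht
  · rw [abs_of_nonneg ht] at hx
    exact wave_eq_zero_of_nonneg hsmooth hwave hdata₀ hdata₁ ht hx
  · rw [abs_of_nonpos ht] at hx
    have hrev : ∀ s y, deriv (fun r => u (-r) y) s = -deriv (fun r => u r y) (-s) := fun s y =>
      deriv_comp_neg (fun r => u r y) s
    have h := wave_eq_zero_of_nonneg (u := fun s => u (-s)) (x₀ := x₀) (R := R)
      (hsmooth.comp (contDiff_fst.neg.prodMk contDiff_snd)) ?_ ?_ ?_ (neg_nonneg.2 ht) hx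
    · simpa using h
    · intro s y
      rw [← hwave (-s) y]
      simp only [hrev, deriv.fun_neg]
      rw [deriv_comp_neg (fun s => deriv (fun r => u r y) s) s, neg_neg]
    · simpa using hdata₀
    · intro y hy
      simpa [hrev] using hdata₁ y hy

end Cone


/-- **Finite propagation speed** for the wave equation: if `u : ℝ × ℝⁿ → ℝ` is a smooth
solution of `∂_t² u = Σ_j ∂²_{x_j} u` whose Cauchy data vanish on the closed ball of
radius `R` about `x₀`, then `u` vanishes on the solid light cone
`{(t,x) : |t| ≤ R, |x − x₀| ≤ R − |t|}`. -/
theorem finite_propagation_speed (n : ℕ) (hn : 1 ≤ n)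
    (u : ℝ → EuclideanSpace ℝ (Fin n) → ℝ)
    (hsmooth : ContDiff ℝ (⊤ : ℕ∞) (fun p : ℝ × EuclideanSpace ℝ (Fin n) => u p.1 p.2))
    (hwave : ∀ (t : ℝ) (x : EuclideanSpace ℝ (Fin n)),
      deriv (fun s => deriv (fun r => u r x) s) t
        = ∑ j : Fin n,
            fderiv ℝ (fun y => fderiv ℝ (u t) y (EuclideanSpace.single j (1 : ℝ))) x
              (EuclideanSpace.single j (1 : ℝ)))
    (x₀ : EuclideanSpace ℝ (Fin n)) (R : ℝ) (hR : 0 < R)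
    (hdata₀ : ∀ x, ‖x - x₀‖ ≤ R → u 0 x = 0)
    (hdata₁ : ∀ x, ‖x - x₀‖ ≤ R → deriv (fun s => u s x) 0 = 0) :
    ∀ (t : ℝ) (x : EuclideanSpace ℝ (Fin n)), |t| ≤ R → ‖x - x₀‖ ≤ R - |t| → u t x = 0 := by
  intro t x ht hx
  have hmap : Continuous fun s : ℝ => u (s * t) (x₀ + s • (x - x₀)) :=
    hsmooth.continuous.comp (by fun_prop :
      Continuous fun s : ℝ => (s * t, x₀ + s • (x - x₀)))
  have hvanish : EqOn (fun s : ℝ => u (s * t) (x₀ + s • (x - x₀))) (fun _ => 0) (Ioo 0 1) := by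
    intro s hs
    refine wave_eq_zero_of_norm_lt hsmooth hwave (fun y hy => hdata₀ y hy.le)
      (fun y hy => hdata₁ y hy.le) (x₀ := x₀) (R := R) ?_
    rw [add_sub_cancel_left, norm_smul, abs_mul, Real.norm_of_nonneg hs.1.le, abs_of_pos hs.1]
    nlinarith [hs.1, hs.2, mul_le_mul_of_nonneg_left hx hs.1.le, mul_pos hR (sub_pos.2 hs.2)]
  have hclosure := hvanish.closure hmap continuous_const
  rw [closure_Ioo zero_ne_one] at hclosure
  simpa using hclosure (right_mem_Icc.2 zero_le_one)
end
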